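/- Let q ≥ 3 be an integer. Assume (β_n,h_n) → (β_0,h_0) with β_n − β_0 = o(n^{−3/4}) and h_n − h_0 = o(n^{−3/4}), let x = (1/2, 1/(2(q−1)), …, 1/(2(q−1))) be the unique global minimizer of f_{β_0,h_0}, and let u = (1−q, 1, …, 1). Define the random variables T ∈ ℝ and V ∈ H ∩ u^⊥ by N = n x + n^{3/4} T u + n^{1/2} V, where N is distributed under μ_{β_n,h_n,n}. Then (T,V) converges in distribution, and in the limit: (i) T and V are independent; (ii) T has the probability density on ℝ proportional to exp(−(4(q−1)^4/3) t^4) dt; (iii) V is the centered Gaussian vector with covariance matrix (q/(2(q−1)²(q−2))) D, where D has first row and first column zero, D_{jj} = q−2 for 2 ≤ j ≤ q, and D_{jk} = −1 for distinct j,k ≥ 2; this covariance matrix has rank q − 2. -/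

import Mathlib

open Real Filter Finset Topology MeasureTheory

/-- The simplex `Ω = {x ∈ ℝ^q : x_1 + ⋯ + x_q = 1, x_i ≥ 0}`. -/
def simplex (q : ℕ) : Set (Fin q → ℝ) := {x | (∀ i, 0 ≤ x i) ∧ ∑ i, x i = 1}

/-- The Curie–Weiss Potts free energy
`f_{β,h}(x) = ∑ x_i log x_i − (β/2) ∑ x_i² − h x_1` (with `0 log 0 = 0`). -/
noncomputable def freeEnergy (q : ℕ) [NeZero q] (β h : ℝ) (x : Fin q → ℝ) : ℝ :=
  ∑ i, x i * Real.log (x i) - β / 2 * ∑ i, x i ^ 2 - h * x 0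

/-- Boltzmann weight of a spin configuration `σ : Fin n → Fin q`:
`exp((β/n) ∑_{i<j} δ_{σ_i,σ_j} + h ∑_i δ_{σ_i,1})`. -/
noncomputable def cwWeight (q n : ℕ) [NeZero q] (β h : ℝ) (σ : Fin n → Fin q) : ℝ :=
  Real.exp (β / n *
      ∑ p ∈ Finset.univ.filter (fun p : Fin n × Fin n => p.1 < p.2),
        (if σ p.1 = σ p.2 then (1 : ℝ) else 0)
    + h * ∑ i, (if σ i = 0 then (1 : ℝ) else 0))

/-- The partition function `Z_{β,h,n}`. -/
noncomputable def cwZ (q n : ℕ) [NeZero q] (β h : ℝ) : ℝ :=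
  ∑ σ : Fin n → Fin q, cwWeight q n β h σ

/-- The empirical color count `N_k(σ) = #{i : σ_i = k}`. -/
def colorCount {q n : ℕ} (σ : Fin n → Fin q) (k : Fin q) : ℕ :=
  (Finset.univ.filter (fun i => σ i = k)).card

/-- Probability of an event under the Curie–Weiss Potts measure `μ_{β,h,n}`. -/
noncomputable def cwProb (q n : ℕ) [NeZero q] (β h : ℝ) (A : Set (Fin n → Fin q)) : ℝ :=
  (∑ σ : Fin n → Fin q, Set.indicator A (cwWeight q n β h) σ) / cwZ q n β h

/-- Expectation of an observable under the Curie–Weiss Potts measure `μ_{β,h,n}`. -/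
noncomputable def cwExp (q n : ℕ) [NeZero q] (β h : ℝ) (g : (Fin n → Fin q) → ℝ) : ℝ :=
  (∑ σ : Fin n → Fin q, cwWeight q n β h σ * g σ) / cwZ q n β h

/-- `β_0 = 4(q−1)/q`. -/
noncomputable def beta0 (q : ℕ) : ℝ := 4 * ((q : ℝ) - 1) / q

/-- `h_0 = log(q−1) − 2(q−2)/q`. -/
noncomputable def h0 (q : ℕ) : ℝ := Real.log ((q : ℝ) - 1) - 2 * ((q : ℝ) - 2) / q

/-- The point `x_0 = (1/2, 1/(2(q−1)), …, 1/(2(q−1)))`. -/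
noncomputable def xzero (q : ℕ) [NeZero q] : Fin q → ℝ :=
  fun i => if i = 0 then 1 / 2 else 1 / (2 * ((q : ℝ) - 1))

/-- The vector `u = (1−q, 1, …, 1)`. -/
noncomputable def uvec (q : ℕ) [NeZero q] : Fin q → ℝ :=
  fun i => if i = 0 then 1 - (q : ℝ) else 1

/-- The statistic `T` in the decomposition `N = n x + n^{3/4} T u + n^{1/2} V`
(orthogonal projection of `N − n x` onto the line `ℝ u`, rescaled). -/
noncomputable def Tstat (q n : ℕ) [NeZero q] (σ : Fin n → Fin q) : ℝ :=
  (∑ i, ((colorCount σ i : ℝ) - n * xzero q i) * uvec q i)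
    / ((n : ℝ) ^ ((3 : ℝ) / 4) * ∑ i, (uvec q i) ^ 2)

/-- The statistic `V ∈ H ∩ u^⊥` in the decomposition `N = n x + n^{3/4} T u + n^{1/2} V`. -/
noncomputable def Vstat (q n : ℕ) [NeZero q] (σ : Fin n → Fin q) : Fin q → ℝ :=
  fun k => ((colorCount σ k : ℝ) - n * xzero q k
    - (n : ℝ) ^ ((3 : ℝ) / 4) * Tstat q n σ * uvec q k) / (n : ℝ) ^ ((1 : ℝ) / 2)

/-- A probability measure on `ℝ^q` is the centered Gaussian with covariance matrix
`K` when each linear marginal `y ↦ ∑ a_i y_i` is the real Gaussian `N(0, aᵀKa)`. -/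
def IsCenteredGaussianWithCov (q : ℕ) (K : Matrix (Fin q) (Fin q) ℝ)
    (ν : Measure (Fin q → ℝ)) : Prop :=
  IsProbabilityMeasure ν ∧
  ∀ a : Fin q → ℝ, ν.map (fun y => ∑ i, a i * y i)
    = ProbabilityTheory.gaussianReal 0 (Real.toNNReal (∑ i, ∑ j, a i * K i j * a j))

/-- The covariance matrix of the limit of `V`. -/
noncomputable def covV (q : ℕ) [NeZero q] : Matrix (Fin q) (Fin q) ℝ :=
  Matrix.of fun i j =>
    (q : ℝ) / (2 * ((q : ℝ) - 1) ^ 2 * ((q : ℝ) - 2)) *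
      (if i = 0 ∨ j = 0 then 0 else if i = j then (q : ℝ) - 2 else -1)

lemma tendsto_integral_of_tendsto_integral_cexp {ι : Type*} [Fintype ι]
    (μ : ℕ → Measure (ℝ × (ι → ℝ))) (ν : Measure (ℝ × (ι → ℝ)))
    [∀ n, IsProbabilityMeasure (μ n)] [IsProbabilityMeasure ν]
    (h : ∀ (a : ℝ) (b : ι → ℝ), Tendsto
      (fun n => ∫ p, Complex.exp ((a * p.1 + ∑ i, b i * p.2 i : ℝ) * Complex.I) ∂(μ n)) atTop
      (𝓝 (∫ p, Complex.exp ((a * p.1 + ∑ i, b i * p.2 i : ℝ) * Complex.I) ∂ν)))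
    {g : ℝ × (ι → ℝ) → ℝ} (hg : Continuous g) (hb : ∃ C : ℝ, ∀ p, |g p| ≤ C) :
    Tendsto (fun n => ∫ p, g p ∂(μ n)) atTop (𝓝 (∫ p, g p ∂ν)) := by
  let Φ : ℝ × (ι → ℝ) → WithLp 2 (ℝ × EuclideanSpace ℝ ι) :=
    fun p => WithLp.toLp 2 (p.1, WithLp.toLp 2 p.2)
  have hΦ : Continuous Φ := by fun_prop
  have hcf : ∀ (ρ : Measure (ℝ × (ι → ℝ))) (t : WithLp 2 (ℝ × EuclideanSpace ℝ ι)),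
      charFun (ρ.map Φ) t
        = ∫ p, Complex.exp ((t.fst * p.1 + ∑ i, t.snd i * p.2 i : ℝ) * Complex.I) ∂ρ := by
    intro ρ t
    rw [charFun_apply, integral_map hΦ.aemeasurable (by fun_prop)]
    simp [Φ, WithLp.prod_inner_apply, PiLp.inner_apply]
  let P : ℕ → ProbabilityMeasure (WithLp 2 (ℝ × EuclideanSpace ℝ ι)) :=
    fun n => ⟨(μ n).map Φ, Measure.isProbabilityMeasure_map hΦ.aemeasurable⟩
  let P₀ : ProbabilityMeasure (WithLp 2 (ℝ × EuclideanSpace ℝ ι)) :=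
    ⟨ν.map Φ, Measure.isProbabilityMeasure_map hΦ.aemeasurable⟩
  have hP : Tendsto P atTop (𝓝 P₀) := by
    refine ProbabilityMeasure.tendsto_of_tendsto_charFun fun t => ?_
    simp only [P, P₀, ProbabilityMeasure.coe_mk, hcf]
    exact h _ _
  obtain ⟨C, hC⟩ := hb
  let Ψ : WithLp 2 (ℝ × EuclideanSpace ℝ ι) → ℝ × (ι → ℝ) :=
    fun p => (p.fst, WithLp.ofLp p.snd)
  have hΨ : Continuous Ψ := by fun_prop
  let G : BoundedContinuousFunction (WithLp 2 (ℝ × EuclideanSpace ℝ ι)) ℝ :=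
    BoundedContinuousFunction.ofNormedAddCommGroup (g ∘ Ψ) (hg.comp hΨ) C (fun x => hC _)
  have key := (ProbabilityMeasure.tendsto_iff_forall_integral_tendsto.1 hP) G
  have hi : ∀ ρ : Measure (ℝ × (ι → ℝ)), ∫ x, G x ∂(ρ.map Φ) = ∫ p, g p ∂ρ := by
    intro ρ
    rw [integral_map hΦ.aemeasurable G.continuous.aestronglyMeasurable]
    rfl
  simpa only [P, P₀, ProbabilityMeasure.coe_mk, hi] using key

/-- An orthonormal basis of the hyperplane `H ∩ u^⊥ = {v | v 0 = 0, ∑ v = 0}`. -/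
lemma exists_orthonormal_family (q : ℕ) [NeZero q] (hq : 3 ≤ q) :
    ∃ e : Fin (q - 2) → Fin q → ℝ, (∀ j, e j 0 = 0) ∧ (∀ j, ∑ k, e j k = 0) ∧
      (∀ i j, ∑ k, e i k * e j k = if i = j then 1 else 0) ∧
      (∀ v : Fin q → ℝ, v 0 = 0 → ∑ k, v k = 0 → ∀ k, v k = ∑ j, (∑ l, e j l * v l) * e j k) := by
  let a : EuclideanSpace ℝ (Fin q) := EuclideanSpace.single 0 1
  let o : EuclideanSpace ℝ (Fin q) := WithLp.toLp 2 (fun _ => 1)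
  let K : Submodule ℝ (EuclideanSpace ℝ (Fin q)) := Submodule.span ℝ (Set.range ![a, o])
  have hlin : LinearIndependent ℝ ![a, o] := by
    rw [LinearIndependent.pair_iff]
    intro s t h
    have h1 := congrArg (fun (v : EuclideanSpace ℝ (Fin q)) => v ⟨1, by omega⟩) h
    have h0 := congrArg (fun (v : EuclideanSpace ℝ (Fin q)) => v 0) h
    have h10 : (⟨1, by omega⟩ : Fin q) ≠ 0 := by
      intro h; have := congrArg Fin.val h; simp at this
    simp [a, o, h10] at h1 h0
    subst h1
    simpa using h0
  have hK : Module.finrank ℝ K = 2 := by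
    simpa using finrank_span_eq_card hlin
  have hKo : Module.finrank ℝ Kᗮ = q - 2 := by
    have := Submodule.finrank_add_finrank_orthogonal K
    rw [hK] at this
    rw [finrank_euclideanSpace, Fintype.card_fin] at this
    omega
  have hmem : ∀ v : EuclideanSpace ℝ (Fin q), v ∈ Kᗮ ↔ v 0 = 0 ∧ ∑ k, v k = 0 := by
    intro v
    constructor
    · intro hv
      rw [Submodule.mem_orthogonal] at hv
      have h1 := hv a (Submodule.subset_span ⟨0, rfl⟩)
      have h2 := hv o (Submodule.subset_span ⟨1, rfl⟩)
      simp [a, o, PiLp.inner_apply] at h1 h2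
      exact ⟨h1, h2⟩
    · rintro ⟨h1, h2⟩
      rw [Submodule.mem_orthogonal']
      intro u hu
      induction hu using Submodule.span_induction with
      | mem x hx =>
        obtain ⟨i, rfl⟩ := hx
        fin_cases i
        · simpa [a, PiLp.inner_apply] using h1
        · simpa [o, PiLp.inner_apply] using h2
      | zero => simp
      | add x y _ _ hx hy => rw [inner_add_right, hx, hy, add_zero]
      | smul c x _ hx => rw [inner_smul_right, hx, mul_zero]
  let b : OrthonormalBasis (Fin (q - 2)) ℝ Kᗮ :=
    (stdOrthonormalBasis ℝ Kᗮ).reindex (finCongr hKo)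
  refine ⟨fun j k => (b j : EuclideanSpace ℝ (Fin q)) k, fun j => ((hmem _).1 (b j).2).1,
    fun j => ((hmem _).1 (b j).2).2, fun i j => ?_, fun v h0 hs k => ?_⟩
  · have := orthonormal_iff_ite.1 b.orthonormal i j
    rw [← this, Submodule.coe_inner, PiLp.inner_apply]
    refine Finset.sum_congr rfl fun k _ => ?_
    rw [RCLike.inner_apply, conj_trivial, mul_comm]
  · have := b.sum_repr' ⟨WithLp.toLp 2 v, (hmem _).2 ⟨h0, hs⟩⟩
    have := congrArg (fun w : Kᗮ => (w : EuclideanSpace ℝ (Fin q)) k) this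
    simp only [AddSubmonoidClass.coe_finsetSum, Submodule.coe_smul, Submodule.coe_inner,
      WithLp.ofLp_sum, Finset.sum_apply, PiLp.smul_apply, smul_eq_mul, PiLp.inner_apply,
      RCLike.inner_apply, conj_trivial] at this
    rw [← this]
    simp only [mul_comm]

lemma sum_ite_eq_zero_else (q : ℕ) [NeZero q] (a b : ℝ) :
    ∑ k : Fin q, (if k = 0 then a else b) = a + ((q : ℝ) - 1) * b := by
  have h : ∀ k : Fin q, (if k = 0 then a else b) = (if k = 0 then a - b else 0) + b := by
    intro k; split_ifs <;> ring
  simp only [h, Finset.sum_add_distrib, Finset.sum_ite_eq', Finset.mem_univ, if_true,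
    Finset.sum_const, Finset.card_univ, Fintype.card_fin, nsmul_eq_mul]
  ring

/-- An orthonormal family of vectors spanning `{v | v 0 = 0, ∑ v = 0}`. -/
structure IsTransverseBasis {q : ℕ} [NeZero q] {ι : Type*} [Fintype ι] [DecidableEq ι]
    (e : ι → Fin q → ℝ) : Prop where
  apply_zero : ∀ j, e j 0 = 0
  sum_eq_zero : ∀ j, ∑ k, e j k = 0
  orthonormal : ∀ i j, ∑ k, e i k * e j k = if i = j then 1 else 0
  expand : ∀ v : Fin q → ℝ, v 0 = 0 → ∑ k, v k = 0 →
    ∀ k, v k = ∑ j, (∑ l, e j l * v l) * e j k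

namespace IsTransverseBasis

variable {q : ℕ} [NeZero q] {ι : Type*} [Fintype ι] [DecidableEq ι] {e : ι → Fin q → ℝ}

lemma sum_sq_combination (he : IsTransverseBasis e) (w : ι → ℝ) :
    ∑ k, (∑ j, w j * e j k) ^ 2 = ∑ j, w j ^ 2 := by
  have h : ∀ k, (∑ j, w j * e j k) ^ 2 = ∑ i, ∑ j, w i * w j * (e i k * e j k) := by
    intro k
    rw [sq, Finset.sum_mul_sum]
    exact Finset.sum_congr rfl fun i _ => Finset.sum_congr rfl fun j _ => by ring
  simp only [h]
  rw [Finset.sum_comm]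
  refine Finset.sum_congr rfl fun i _ => ?_
  rw [Finset.sum_comm]
  simp only [← Finset.mul_sum, he.orthonormal]
  simp [sq]

lemma sum_combination (he : IsTransverseBasis e) (w : ι → ℝ) :
    ∑ k, ∑ j, w j * e j k = 0 := by
  rw [Finset.sum_comm]
  simp [← Finset.mul_sum, he.sum_eq_zero]

lemma combination_zero (he : IsTransverseBasis e) (w : ι → ℝ) :
    ∑ j, w j * e j 0 = 0 := by
  simp [he.apply_zero]

lemma sum_sq_eq (he : IsTransverseBasis e) {v : Fin q → ℝ} (h0 : v 0 = 0) (hs : ∑ k, v k = 0) :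
    ∑ k, v k ^ 2 = ∑ j, (∑ l, e j l * v l) ^ 2 := by
  rw [← he.sum_sq_combination]
  exact Finset.sum_congr rfl fun k _ => by rw [he.expand v h0 hs k]

lemma sum_mul_eq (he : IsTransverseBasis e) (hq : 2 ≤ q) (k l : Fin q) :
    ∑ j, e j k * e j l
      = if k = 0 ∨ l = 0 then 0 else (if k = l then 1 else 0) - 1 / ((q : ℝ) - 1) := by
  have hq' : (2 : ℝ) ≤ q := by exact_mod_cast hq
  have hm : (q : ℝ) - 1 ≠ 0 := by linarith
  by_cases hl : l = 0
  · simp [hl, he.apply_zero]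
  have hv := he.expand (fun k => (if k = l then 1 else 0)
    - if k = 0 then 0 else 1 / ((q : ℝ) - 1)) (by simp [Ne.symm hl]) (by
      rw [Finset.sum_sub_distrib, sum_ite_eq_zero_else]
      simp [hm]) k
  have hin : ∀ j, ∑ i, e j i * ((if i = l then 1 else 0)
      - if i = 0 then 0 else 1 / ((q : ℝ) - 1)) = e j l := by
    intro j
    have : ∀ i, e j i * ((if i = l then 1 else 0) - if i = 0 then 0 else 1 / ((q : ℝ) - 1))
        = (if i = l then e j i else 0) - e j i * (1 / ((q : ℝ) - 1)) := by
      intro i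
      by_cases hi : i = 0
      · subst hi; simp [he.apply_zero]
      · simp only [hi, if_false]; split_ifs <;> ring
    simp only [this, Finset.sum_sub_distrib, ← Finset.sum_mul, he.sum_eq_zero]
    simp
  simp only [hin] at hv
  by_cases hk : k = 0
  · simp [hk, he.apply_zero]
  · simp only [hk, hl, or_self, if_false] at hv ⊢
    rw [hv]
    exact Finset.sum_congr rfl fun j _ => mul_comm _ _

lemma covV_eq (he : IsTransverseBasis e) (hq : 3 ≤ q) (k l : Fin q) :
    covV q k l = (q : ℝ) / (2 * ((q : ℝ) - 1) * ((q : ℝ) - 2)) * ∑ j, e j k * e j l := by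
  have hq' : (3 : ℝ) ≤ q := by exact_mod_cast hq
  have hm : (q : ℝ) - 1 ≠ 0 := by linarith
  have hm2 : (q : ℝ) - 2 ≠ 0 := by linarith
  rw [he.sum_mul_eq (by omega)]
  simp only [covV, Matrix.of_apply]
  split_ifs <;> field_simp <;> ring

lemma quadForm_covV (he : IsTransverseBasis e) (hq : 3 ≤ q) (a : Fin q → ℝ) :
    ∑ k, ∑ l, a k * covV q k l * a l
      = (q : ℝ) / (2 * ((q : ℝ) - 1) * ((q : ℝ) - 2)) * ∑ j, (∑ k, a k * e j k) ^ 2 := by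
  have h : ∀ j, (∑ k, a k * e j k) ^ 2 = ∑ k, ∑ l, a k * (e j k * e j l) * a l := by
    intro j
    rw [sq, Finset.sum_mul_sum]
    exact Finset.sum_congr rfl fun i _ => Finset.sum_congr rfl fun j _ => by ring
  simp only [h, he.covV_eq hq]
  have h' : ∑ j, ∑ k, ∑ l, a k * (e j k * e j l) * a l
      = ∑ k, ∑ l, ∑ j, a k * (e j k * e j l) * a l := by
    rw [Finset.sum_comm]
    exact Finset.sum_congr rfl fun k _ => Finset.sum_comm
  rw [h']
  simp only [Finset.mul_sum, Finset.sum_mul]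
  exact Finset.sum_congr rfl fun k _ => Finset.sum_congr rfl fun l _ =>
    Finset.sum_congr rfl fun j _ => by ring

lemma rank_covV (he : IsTransverseBasis e) (hq : 3 ≤ q) : (covV q).rank = Fintype.card ι := by
  have hq' : (3 : ℝ) ≤ q := by exact_mod_cast hq
  let A : Matrix ι (Fin q) ℝ := Matrix.of e
  have h1 : A * A.transpose = 1 := by
    ext i j
    simp [A, Matrix.mul_apply, he.orthonormal, Matrix.one_apply]
  have h2 : covV q = ((q : ℝ) / (2 * ((q : ℝ) - 1) * ((q : ℝ) - 2))) • (A.transpose * A) := by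
    ext k l
    rw [he.covV_eq hq, Matrix.smul_apply, Matrix.mul_apply]
    simp [A]
  have h3 : (q : ℝ) / (2 * ((q : ℝ) - 1) * ((q : ℝ) - 2)) ≠ 0 := by
    have h1 : (q : ℝ) - 1 ≠ 0 := by linarith
    have h2 : (q : ℝ) - 2 ≠ 0 := by linarith
    positivity
  rw [h2, Matrix.rank_smul_of_mem_nonZeroDivisors _ (mem_nonZeroDivisors_of_ne_zero h3),
    Matrix.rank_transpose_mul_self,
    ← Matrix.rank_self_mul_transpose, h1, Matrix.rank_one]

/-- The Gaussian vector with i.i.d. coordinates of variance `v` in the basis `e` -/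
lemma isCenteredGaussianWithCov (he : IsTransverseBasis e) (hq : 3 ≤ q) :
    IsCenteredGaussianWithCov q (covV q)
      ((Measure.pi fun _ : ι => ProbabilityTheory.gaussianReal 0
        (Real.toNNReal ((q : ℝ) / (2 * ((q : ℝ) - 1) * ((q : ℝ) - 2))))).map
        (fun w k => ∑ j, w j * e j k)) := by
  have hq' : (3 : ℝ) ≤ q := by exact_mod_cast hq
  set s : ℝ := (q : ℝ) / (2 * ((q : ℝ) - 1) * ((q : ℝ) - 2)) with hs
  have hs0 : 0 ≤ s := by
    have h1 : 0 ≤ (q : ℝ) - 1 := by linarith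
    have h2 : 0 ≤ (q : ℝ) - 2 := by linarith
    positivity
  have hm : Measurable fun (w : ι → ℝ) (k : Fin q) => ∑ j, w j * e j k := by fun_prop
  refine ⟨Measure.isProbabilityMeasure_map hm.aemeasurable, fun a => ?_⟩
  have : IsProbabilityMeasure (Measure.map (fun w : ι → ℝ => fun k => ∑ j, w j * e j k)
    (Measure.pi fun _ : ι => ProbabilityTheory.gaussianReal 0 (Real.toNNReal s))) :=
    Measure.isProbabilityMeasure_map hm.aemeasurable
  have hc : Measurable ((fun y : Fin q → ℝ => ∑ i, a i * y i) ∘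
      (fun w : ι → ℝ => fun k => ∑ j, w j * e j k)) := Measurable.comp (by fun_prop) hm
  rw [Measure.map_map (by fun_prop) hm]
  have : IsProbabilityMeasure (Measure.map ((fun y => ∑ i, a i * y i) ∘
      (fun w : ι → ℝ => fun k => ∑ j, w j * e j k))
    (Measure.pi fun _ : ι => ProbabilityTheory.gaussianReal 0 (Real.toNNReal s))) :=
    Measure.isProbabilityMeasure_map hc.aemeasurable
  refine Measure.ext_of_charFun ?_
  ext t
  rw [charFun_apply, integral_map hc.aemeasurable (by fun_prop),
    ProbabilityTheory.charFun_gaussianReal, he.quadForm_covV hq, ← hs]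
  have h1 : ∀ w : ι → ℝ, Complex.exp ((inner ℝ (((fun y : Fin q → ℝ => ∑ i, a i * y i) ∘
      (fun w : ι → ℝ => fun k => ∑ j, w j * e j k)) w) t : ℝ) * Complex.I)
      = ∏ j, Complex.exp (((t * ∑ k, a k * e j k : ℝ) * w j : ℂ) * Complex.I) := by
    intro w
    rw [← Complex.exp_sum, ← Finset.sum_mul]
    congr 2
    simp only [Function.comp_apply, RCLike.inner_apply, conj_trivial]
    push_cast
    simp only [Finset.mul_sum, Finset.sum_mul]
    rw [Finset.sum_comm]
    exact Finset.sum_congr rfl fun i _ => Finset.sum_congr rfl fun j _ => by ring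
  simp only [h1]
  rw [integral_fintype_prod_eq_prod
    (f := fun j (x : ℝ) => Complex.exp (((t * ∑ k, a k * e j k : ℝ) * x : ℂ) * Complex.I))]
  simp only [← charFun_apply_real, ProbabilityTheory.charFun_gaussianReal]
  rw [← Complex.exp_sum, Real.coe_toNNReal _ hs0,
    Real.coe_toNNReal _ (mul_nonneg hs0 (Finset.sum_nonneg fun _ _ => sq_nonneg _))]
  congr 1
  push_cast
  simp only [mul_zero, zero_mul, zero_sub, Finset.sum_neg_distrib, neg_inj, mul_pow]
  rw [Finset.mul_sum, Finset.sum_mul, Finset.sum_div]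
  exact Finset.sum_congr rfl fun i _ => by ring

end IsTransverseBasis

/-- The sign distinguishing the colour `0` (value `-1`) from the other colours (value `1`). -/
noncomputable def colorSign (q : ℕ) [NeZero q] (k : Fin q) : ℝ := if k = 0 then -1 else 1

/-- Moment generating function of the pair (sign, position) of one spin of law `xzero`. -/
noncomputable def siteMGF (q : ℕ) [NeZero q] (y : ℝ) (s : Fin q → ℝ) : ℝ :=
  ∑ k, xzero q k * Real.exp (y * colorSign q k + s k)

/-- The rate function of the Hubbard–Stratonovich transform of the model at `(β_0, h_0)`. -/
noncomputable def rateFun (q : ℕ) [NeZero q] (y : ℝ) (s : Fin q → ℝ) : ℝ :=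
  y ^ 2 / 2 + (∑ k, s k ^ 2) / (2 * beta0 q) - Real.log (siteMGF q y s)

lemma xzero_pos {q : ℕ} [NeZero q] (hq : 3 ≤ q) (k : Fin q) : 0 < xzero q k := by
  have hq' : (3 : ℝ) ≤ q := by exact_mod_cast hq
  unfold xzero
  split_ifs
  · norm_num
  · apply div_pos one_pos; linarith

lemma sum_xzero {q : ℕ} [NeZero q] (hq : 3 ≤ q) : ∑ k, xzero q k = 1 := by
  have hq' : (3 : ℝ) ≤ q := by exact_mod_cast hq
  have hm : (q : ℝ) - 1 ≠ 0 := by linarith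
  simp only [xzero, sum_ite_eq_zero_else]
  field_simp; norm_num

lemma beta0_pos {q : ℕ} (hq : 3 ≤ q) : 0 < beta0 q := by
  have hq' : (3 : ℝ) ≤ q := by exact_mod_cast hq
  exact div_pos (by linarith) (by linarith)

lemma siteMGF_pos {q : ℕ} [NeZero q] (hq : 3 ≤ q) (y : ℝ) (s : Fin q → ℝ) :
    0 < siteMGF q y s :=
  Finset.sum_pos (fun k _ => mul_pos (xzero_pos hq k) (Real.exp_pos _)) ⟨0, Finset.mem_univ _⟩

lemma rateFun_eq {q : ℕ} [NeZero q] (hq : 3 ≤ q) (y : ℝ) {s : Fin q → ℝ} (hs0 : s 0 = 0)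
    (hs : ∑ k, s k = 0) :
    ∃ x ∈ simplex q, rateFun q y s = freeEnergy q (beta0 q) (h0 q) x
      - freeEnergy q (beta0 q) (h0 q) (xzero q) + (y - (1 - 2 * x 0)) ^ 2 / 2
      + (∑ k, (s k - beta0 q * (if k = 0 then 0 else x k - (1 - x 0) / ((q : ℝ) - 1))) ^ 2)
        / (2 * beta0 q) := by
  have hq' : (3 : ℝ) ≤ q := by exact_mod_cast hq
  have hm : 0 < (q : ℝ) - 1 := by linarith
  set Z := siteMGF q y s with hZ
  have hZp : 0 < Z := siteMGF_pos hq y s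
  set x : Fin q → ℝ := fun k => xzero q k * Real.exp (y * colorSign q k + s k) / Z with hx
  have hxs : ∑ k, x k = 1 := by
    simp only [hx, ← Finset.sum_div]
    exact div_self hZp.ne'
  have hxp : ∀ k, 0 < x k := fun k => div_pos (mul_pos (xzero_pos hq k) (Real.exp_pos _)) hZp
  refine ⟨x, ⟨fun k => (hxp k).le, hxs⟩, ?_⟩
  have hlog : ∀ k, Real.log (x k)
      = Real.log (xzero q k) + (y * colorSign q k + s k) - Real.log Z := by
    intro k
    simp only [hx]
    rw [Real.log_div (mul_pos (xzero_pos hq k) (Real.exp_pos _)).ne' hZp.ne',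
      Real.log_mul (xzero_pos hq k).ne' (Real.exp_pos _).ne', Real.log_exp]
  have hsplit : ∀ (f : Fin q → ℝ) (a b : ℝ), ∑ k, f k * (if k = 0 then a else b)
      = f 0 * a + (∑ k, f k - f 0) * b := by
    intro f a b
    have : ∀ k, f k * (if k = 0 then a else b)
        = (if k = 0 then f 0 * (a - b) else 0) + f k * b := by
      intro k
      split_ifs with h
      · subst h; ring
      · ring
    simp only [this, Finset.sum_add_distrib, ← Finset.sum_mul, Finset.sum_ite_eq',
      Finset.mem_univ, if_true]
    ring
  have hlx : ∀ k, Real.log (xzero q k)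
      = if k = 0 then - Real.log 2 else - Real.log 2 - Real.log ((q : ℝ) - 1) := by
    intro k
    unfold xzero
    split_ifs
    · rw [one_div, Real.log_inv]
    · rw [one_div, Real.log_inv, Real.log_mul two_ne_zero hm.ne']; ring
  have e1 : ∑ k, x k * Real.log (x k) = - Real.log 2 - (1 - x 0) * Real.log ((q : ℝ) - 1)
      + y * (1 - 2 * x 0) + ∑ k, x k * s k - Real.log Z := by
    have : ∀ k, x k * Real.log (x k) = x k * Real.log (xzero q k) + y * (x k * colorSign q k)
        + x k * s k - x k * Real.log Z := by
      intro k; rw [hlog]; ring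
    simp only [this, Finset.sum_add_distrib, Finset.sum_sub_distrib, ← Finset.sum_mul,
      ← Finset.mul_sum, hlx, colorSign, hsplit, hxs]
    ring
  have e2 : ∑ k, xzero q k * Real.log (xzero q k)
      = - Real.log 2 - Real.log ((q : ℝ) - 1) / 2 := by
    simp only [hlx, hsplit, sum_xzero hq]
    simp [xzero]; ring
  have e3 : ∑ k, xzero q k ^ 2 = 1 / 4 + 1 / (4 * ((q : ℝ) - 1)) := by
    have : ∀ k, xzero q k ^ 2
        = xzero q k * (if k = 0 then 1 / 2 else 1 / (2 * ((q : ℝ) - 1))) := by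
      intro k; rw [sq]; rfl
    simp only [this, hsplit, sum_xzero hq]
    simp [xzero]; field_simp; ring
  set v : Fin q → ℝ := fun k => if k = 0 then 0 else x k - (1 - x 0) / ((q : ℝ) - 1) with hv
  have e4 : ∑ k, s k * v k = ∑ k, x k * s k := by
    have : ∀ k, s k * v k = x k * s k - s k * ((1 - x 0) / ((q : ℝ) - 1)) := by
      intro k
      simp only [hv]
      split_ifs with h
      · subst h; simp [hs0]
      · ring
    simp only [this, Finset.sum_sub_distrib, ← Finset.sum_mul, hs]
    ring
  have e5 : ∑ k, v k ^ 2 = ∑ k, x k ^ 2 - x 0 ^ 2 - (1 - x 0) ^ 2 / ((q : ℝ) - 1) := by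
    have : ∀ k, v k ^ 2 = x k ^ 2 - x k * (if k = 0 then x 0 else 2 * ((1 - x 0) / ((q : ℝ) - 1)))
        + (if k = 0 then 0 else ((1 - x 0) / ((q : ℝ) - 1)) ^ 2) := by
      intro k
      simp only [hv]
      split_ifs with h
      · subst h; ring
      · ring
    simp only [this, Finset.sum_sub_distrib, Finset.sum_add_distrib, hsplit, hxs,
      sum_ite_eq_zero_else]
    field_simp; ring
  have e6 : ∑ k, (s k - beta0 q * v k) ^ 2
      = ∑ k, s k ^ 2 - 2 * beta0 q * ∑ k, s k * v k + beta0 q ^ 2 * ∑ k, v k ^ 2 := by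
    rw [Finset.mul_sum, Finset.mul_sum, ← Finset.sum_sub_distrib, ← Finset.sum_add_distrib]
    exact Finset.sum_congr rfl fun k _ => by ring
  have hx0 : xzero q 0 = 1 / 2 := by simp [xzero]
  have hb := (beta0_pos hq).ne'
  rw [e6, e4, e5]
  unfold rateFun freeEnergy
  rw [e1, e2, e3, hx0, ← hZ]
  have hb' : beta0 q = 4 * ((q : ℝ) - 1) / q := rfl
  have hh' : h0 q = Real.log ((q : ℝ) - 1) - 2 * ((q : ℝ) - 2) / q := rfl
  rw [hh', hb']
  generalize ∑ k, x k ^ 2 = A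
  generalize ∑ k, s k ^ 2 = B
  generalize ∑ k, x k * s k = C
  generalize Real.log ((q : ℝ) - 1) = L
  field_simp
  ring

lemma rateFun_pos {q : ℕ} [NeZero q] (hq : 3 ≤ q)
    (hxmin : ∀ y ∈ simplex q,
      ((∀ z ∈ simplex q, freeEnergy q (beta0 q) (h0 q) y ≤ freeEnergy q (beta0 q) (h0 q) z)
        ↔ y = xzero q)) (y : ℝ) {s : Fin q → ℝ} (hs0 : s 0 = 0)
    (hs : ∑ k, s k = 0) (hne : y ≠ 0 ∨ s ≠ 0) : 0 < rateFun q y s := by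
  have hq' : (3 : ℝ) ≤ q := by exact_mod_cast hq
  have hm : 0 < (q : ℝ) - 1 := by linarith
  obtain ⟨x, hx, he⟩ := rateFun_eq hq y hs0 hs
  have hmin := (hxmin (xzero q) ⟨fun k => (xzero_pos hq k).le, sum_xzero hq⟩).2 rfl
  have hb := beta0_pos hq
  by_cases hxx : x = xzero q
  · have hx0 : xzero q 0 = 1 / 2 := by simp [xzero]
    have : ∀ k, (if k = 0 then 0 else x k - (1 - x 0) / ((q : ℝ) - 1)) = 0 := by
      intro k
      split_ifs with h
      · rfl
      · rw [hxx, hx0]; simp [xzero, h]; field_simp; norm_num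
    simp only [this, mul_zero, sub_zero] at he
    rw [he, hxx, hx0]
    rcases hne with hy | hs'
    · have : 0 < y ^ 2 := by positivity
      have : 0 ≤ (∑ k, s k ^ 2) / (2 * beta0 q) := by positivity
      linarith
    · obtain ⟨k, hk⟩ := Function.ne_iff.1 hs'
      have : 0 < ∑ k, s k ^ 2 :=
        Finset.sum_pos' (fun _ _ => sq_nonneg _) ⟨k, Finset.mem_univ _, by
          have : s k ≠ 0 := hk
          positivity⟩
      have : 0 < (∑ k, s k ^ 2) / (2 * beta0 q) := by positivity
      nlinarith [sq_nonneg y]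
  · have h1 : ¬ ∀ z ∈ simplex q, freeEnergy q (beta0 q) (h0 q) x
        ≤ freeEnergy q (beta0 q) (h0 q) z := fun h => hxx ((hxmin x hx).1 h)
    have h2 : freeEnergy q (beta0 q) (h0 q) (xzero q)
        < freeEnergy q (beta0 q) (h0 q) x := by
      push Not at h1
      obtain ⟨z, hz, hlt⟩ := h1
      exact (hmin z hz).trans_lt hlt
    rw [he]
    have : 0 ≤ (∑ k, (s k - beta0 q * (if k = 0 then 0 else x k - (1 - x 0) / ((q : ℝ) - 1))) ^ 2)
        / (2 * beta0 q) := by positivity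
    nlinarith [sq_nonneg (y - (1 - 2 * x 0))]

lemma tendsto_log_cosh_div :
    Tendsto (fun y : ℝ => (y ^ 2 / 2 - Real.log (Real.cosh y)) / y ^ 4) (𝓝[≠] 0) (𝓝 (1 / 12)) := by
  have hne : ∀ᶠ y : ℝ in 𝓝[≠] 0, y ≠ 0 := eventually_mem_nhdsWithin
  have hc : ∀ y : ℝ, Real.cosh y ≠ 0 := fun y => (Real.cosh_pos y).ne'
  have hsinh : Tendsto (fun y : ℝ => Real.sinh y / y) (𝓝[≠] 0) (𝓝 1) := by
    have := (hasDerivAt_iff_tendsto_slope.1 (Real.hasDerivAt_sinh 0))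
    simp only [Real.cosh_zero] at this
    refine this.congr fun y => ?_
    simp [slope_def_field]
  refine HasDerivAt.lhopital_zero_nhdsNE (f' := fun y => y - Real.sinh y / Real.cosh y)
    (g' := fun y => 4 * y ^ 3) (Eventually.of_forall fun y => ?_)
    (Eventually.of_forall fun y => ?_) ?_ ?_ ?_ ?_
  · have := ((hasDerivAt_pow 2 y).div_const 2).sub ((Real.hasDerivAt_cosh y).log (hc y))
    convert! this using 1
    push_cast; ring
  · simpa using hasDerivAt_pow 4 y
  · filter_upwards [hne] with y hy
    positivity
  · refine tendsto_nhdsWithin_of_tendsto_nhds ?_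
    have : Continuous fun y : ℝ => y ^ 2 / 2 - Real.log (Real.cosh y) :=
      (by fun_prop : Continuous fun y : ℝ => y ^ 2 / 2).sub (Real.continuous_cosh.log hc)
    simpa using this.tendsto 0
  · refine tendsto_nhdsWithin_of_tendsto_nhds ?_
    have : Continuous fun y : ℝ => y ^ 4 := by fun_prop
    simpa using this.tendsto 0
  refine HasDerivAt.lhopital_zero_nhdsNE (f' := fun y => Real.sinh y ^ 2 / Real.cosh y ^ 2)
    (g' := fun y => 12 * y ^ 2) (Eventually.of_forall fun y => ?_)
    (Eventually.of_forall fun y => ?_) ?_ ?_ ?_ ?_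
  · have := (hasDerivAt_id y).sub ((Real.hasDerivAt_sinh y).div (Real.hasDerivAt_cosh y) (hc y))
    convert! this using 1
    have := hc y
    field_simp; ring
  · convert! (hasDerivAt_pow 3 y).const_mul 4 using 1
    push_cast; ring
  · filter_upwards [hne] with y hy
    positivity
  · refine tendsto_nhdsWithin_of_tendsto_nhds ?_
    have : Continuous fun y : ℝ => y - Real.sinh y / Real.cosh y :=
      continuous_id.sub (Real.continuous_sinh.div Real.continuous_cosh hc)
    simpa using this.tendsto 0
  · refine tendsto_nhdsWithin_of_tendsto_nhds ?_
    have : Continuous fun y : ℝ => 4 * y ^ 3 := by fun_prop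
    simpa using this.tendsto 0
  have hcosh : Tendsto (fun y : ℝ => Real.cosh y) (𝓝[≠] 0) (𝓝 1) := by
    refine tendsto_nhdsWithin_of_tendsto_nhds ?_
    simpa using Real.continuous_cosh.tendsto 0
  have := ((hsinh.pow 2).div (hcosh.pow 2) (by norm_num)).div_const 12
  simp only [one_pow, div_one] at this
  refine this.congr' ?_
  filter_upwards [hne] with y hy
  have := hc y
  simp only [Pi.div_apply]
  field_simp

lemma abs_exp_sub_quadratic_le {x : ℝ} (hx : |x| ≤ 1) :
    |Real.exp x - 1 - x - x ^ 2 / 2| ≤ |x| ^ 3 := by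
  have h := Real.exp_bound hx (n := 3) (by norm_num)
  simp only [Finset.sum_range_succ, Finset.sum_range_zero] at h
  norm_num at h
  have h3 : 0 ≤ |x| ^ 3 := by positivity
  have he : Real.exp x - (1 + x + x ^ 2 / 2) = Real.exp x - 1 - x - x ^ 2 / 2 := by ring
  rw [he] at h
  linarith

lemma siteMGF_eq {q : ℕ} [NeZero q] (hq : 3 ≤ q) (y : ℝ) {s : Fin q → ℝ} (hs0 : s 0 = 0)
    (hs : ∑ k, s k = 0) :
    siteMGF q y s = Real.cosh y * (1 + Real.exp y / (2 * ((q : ℝ) - 1) * Real.cosh y)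
      * ∑ k, (Real.exp (s k) - 1 - s k)) := by
  have hq' : (3 : ℝ) ≤ q := by exact_mod_cast hq
  have hm : (q : ℝ) - 1 ≠ 0 := by linarith
  have h : ∀ k, xzero q k * Real.exp (y * colorSign q k + s k)
      = Real.exp y / (2 * ((q : ℝ) - 1)) * (Real.exp (s k) - 1 - s k)
        + Real.exp y / (2 * ((q : ℝ) - 1)) * s k
        + (if k = 0 then Real.exp (-y) / 2 else Real.exp y / (2 * ((q : ℝ) - 1))) := by
    intro k
    unfold xzero colorSign
    split_ifs with hk
    · subst hk; simp [hs0]; ring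
    · rw [Real.exp_add]; ring_nf
  simp only [siteMGF, h, Finset.sum_add_distrib, ← Finset.mul_sum, hs, sum_ite_eq_zero_else]
  have hc := (Real.cosh_pos y).ne'
  have hc' : 2 * Real.cosh y = Real.exp y + Real.exp (-y) := by rw [Real.cosh_eq]; ring
  generalize ∑ k, (Real.exp (s k) - 1 - s k) = Θ
  field_simp
  linear_combination (-((q : ℝ) - 1)) * hc'

lemma sum_exp_sub_nonneg {ι : Type*} [Fintype ι] (s : ι → ℝ) :
    0 ≤ ∑ k, (Real.exp (s k) - 1 - s k) :=
  Finset.sum_nonneg fun k _ => by linarith [Real.add_one_le_exp (s k)]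

lemma log_siteMGF_eq {q : ℕ} [NeZero q] (hq : 3 ≤ q) (y : ℝ) {s : Fin q → ℝ} (hs0 : s 0 = 0)
    (hs : ∑ k, s k = 0) :
    Real.log (siteMGF q y s) = Real.log (Real.cosh y)
      + Real.log (1 + Real.exp y / (2 * ((q : ℝ) - 1) * Real.cosh y)
      * ∑ k, (Real.exp (s k) - 1 - s k)) := by
  have hq' : (3 : ℝ) ≤ q := by exact_mod_cast hq
  have hm : 0 < (q : ℝ) - 1 := by linarith
  have hc := Real.cosh_pos y
  have := sum_exp_sub_nonneg s
  rw [siteMGF_eq hq y hs0 hs, Real.log_mul hc.ne' (by positivity)]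

lemma rateFun_local_lower {q : ℕ} [NeZero q] (hq : 3 ≤ q) :
    ∃ δ > 0, ∀ (y : ℝ) (s : Fin q → ℝ), s 0 = 0 → ∑ k, s k = 0 → |y| < δ → (∀ k, |s k| < δ) →
      y ^ 4 / 24 + 1 / (16 * ((q : ℝ) - 1)) * ∑ k, s k ^ 2 ≤ rateFun q y s := by
  have hq' : (3 : ℝ) ≤ q := by exact_mod_cast hq
  have hm : 0 < (q : ℝ) - 1 := by linarith
  have h1 : ∀ᶠ y : ℝ in 𝓝 0, y ^ 4 / 24 ≤ y ^ 2 / 2 - Real.log (Real.cosh y) := by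
    have h := tendsto_log_cosh_div.eventually (lt_mem_nhds (show (1 / 24 : ℝ) < 1 / 12 by norm_num))
    rw [eventually_nhdsWithin_iff] at h
    filter_upwards [h] with y hy
    by_cases hy0 : y = 0
    · subst hy0; simp
    · have := hy hy0
      rw [lt_div_iff₀ (by positivity)] at this
      linarith
  have h2 : ∀ᶠ y : ℝ in 𝓝 0, Real.exp y / Real.cosh y < 1.1 := by
    have : Continuous fun y : ℝ => Real.exp y / Real.cosh y :=
      Real.continuous_exp.div Real.continuous_cosh fun y => (Real.cosh_pos y).ne'
    refine this.continuousAt.eventually (gt_mem_nhds ?_)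
    norm_num
  obtain ⟨δ, hδ, hball⟩ := Metric.eventually_nhds_iff.1 (h1.and h2)
  refine ⟨min δ 0.05, by positivity, fun y s hs0 hs hy hsk => ?_⟩
  obtain ⟨hy1, hy2⟩ := hball (y := y) (by simpa using hy.trans_le (min_le_left _ _))
  set Θ := ∑ k, (Real.exp (s k) - 1 - s k) with hΘ
  have hΘ0 : 0 ≤ Θ := sum_exp_sub_nonneg s
  have hΘle : Θ ≤ 0.55 * ∑ k, s k ^ 2 := by
    rw [hΘ, Finset.mul_sum]
    refine Finset.sum_le_sum fun k _ => ?_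
    have hk : |s k| < 0.05 := (hsk k).trans_le (min_le_right _ _)
    have := (abs_le.1 (abs_exp_sub_quadratic_le (hk.le.trans (by norm_num)))).2
    have h3 : |s k| ^ 3 ≤ 0.05 * s k ^ 2 := by
      rw [← sq_abs (s k)]
      nlinarith [sq_nonneg |s k|]
    linarith
  have hS : 0 ≤ ∑ k, s k ^ 2 := Finset.sum_nonneg fun _ _ => sq_nonneg _
  have hc := Real.cosh_pos y
  have hlog : Real.log (1 + Real.exp y / (2 * ((q : ℝ) - 1) * Real.cosh y) * Θ)
      ≤ 1.1 / (2 * ((q : ℝ) - 1)) * (0.55 * ∑ k, s k ^ 2) := by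
    have hp : 0 ≤ Real.exp y / (2 * ((q : ℝ) - 1) * Real.cosh y) := by positivity
    refine (Real.log_le_sub_one_of_pos (by positivity)).trans ?_
    rw [add_sub_cancel_left]
    refine mul_le_mul ?_ hΘle hΘ0 (by positivity)
    rw [mul_comm (2 * ((q : ℝ) - 1)), ← div_div]
    gcongr
  unfold rateFun
  rw [log_siteMGF_eq hq y hs0 hs]
  have hb : (∑ k, s k ^ 2) / (2 * beta0 q)
      = (∑ k, s k ^ 2) / (8 * ((q : ℝ) - 1)) + (∑ k, s k ^ 2) / 8 := by
    unfold beta0; field_simp; ring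
  have hb2 : 2 * ((∑ k, s k ^ 2) / (8 * ((q : ℝ) - 1))) ≤ (∑ k, s k ^ 2) / 8 := by
    rw [← sub_nonneg]
    have : (∑ k, s k ^ 2) / 8 - 2 * ((∑ k, s k ^ 2) / (8 * ((q : ℝ) - 1)))
      = (∑ k, s k ^ 2) * ((q : ℝ) - 3) / (8 * ((q : ℝ) - 1)) := by field_simp; ring
    rw [this]
    have : 0 ≤ (q : ℝ) - 3 := by linarith
    positivity
  have e1 : 1.1 / (2 * ((q : ℝ) - 1)) * (0.55 * ∑ k, s k ^ 2)
      = 2.42 * ((∑ k, s k ^ 2) / (8 * ((q : ℝ) - 1))) := by field_simp; norm_num; ring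
  have e2 : 1 / (16 * ((q : ℝ) - 1)) * ∑ k, s k ^ 2
      = 0.5 * ((∑ k, s k ^ 2) / (8 * ((q : ℝ) - 1))) := by field_simp; norm_num; ring
  have e3 : 0 ≤ (∑ k, s k ^ 2) / (8 * ((q : ℝ) - 1)) := by positivity
  rw [e1] at hlog
  rw [e2, hb]
  linarith

lemma rateFun_growth {q : ℕ} [NeZero q] (hq : 3 ≤ q) (y : ℝ) (s : Fin q → ℝ) :
    y ^ 2 / 4 + (∑ k, s k ^ 2) / (4 * beta0 q) - 1 - beta0 q ≤ rateFun q y s := by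
  have hb := beta0_pos hq
  set S := ∑ k, s k ^ 2 with hSdef
  have hS : 0 ≤ S := Finset.sum_nonneg fun _ _ => sq_nonneg _
  have hlog : Real.log (siteMGF q y s) ≤ |y| + √S := by
    rw [Real.log_le_iff_le_exp (siteMGF_pos hq y s)]
    have hk : ∀ k, xzero q k * Real.exp (y * colorSign q k + s k)
        ≤ xzero q k * Real.exp (|y| + √S) := by
      intro k
      have h1 : y * colorSign q k ≤ |y| := by
        unfold colorSign
        split_ifs
        · simpa using neg_le_abs y
        · simpa using le_abs_self y
      have h2 : s k ≤ √S := by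
        refine Real.le_sqrt_of_sq_le ?_
        exact Finset.single_le_sum (f := fun k => s k ^ 2) (fun _ _ => sq_nonneg _)
          (Finset.mem_univ k)
      have := xzero_pos hq k
      gcongr
    refine (Finset.sum_le_sum fun k _ => hk k).trans ?_
    rw [← Finset.sum_mul, sum_xzero hq, one_mul]
  have h1 : |y| ≤ y ^ 2 / 4 + 1 := by
    rw [← sq_abs y]; nlinarith [sq_nonneg (|y| - 2)]
  have h2 : √S ≤ S / (4 * beta0 q) + beta0 q := by
    rw [← sub_nonneg]
    have : S / (4 * beta0 q) + beta0 q - √S = (√S - 2 * beta0 q) ^ 2 / (4 * beta0 q) := by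
      field_simp
      rw [sub_sq, Real.sq_sqrt hS]; ring
    rw [this]; positivity
  have h3 : S / (2 * beta0 q) = S / (4 * beta0 q) + S / (4 * beta0 q) := by
    field_simp; ring
  unfold rateFun
  rw [← hSdef, h3]
  linarith

lemma continuous_rateFun {q : ℕ} [NeZero q] (hq : 3 ≤ q) :
    Continuous fun p : ℝ × (Fin q → ℝ) => rateFun q p.1 p.2 := by
  have : Continuous fun p : ℝ × (Fin q → ℝ) => siteMGF q p.1 p.2 := by
    unfold siteMGF; fun_prop
  have := this.log fun p => (siteMGF_pos hq p.1 p.2).ne'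
  unfold rateFun
  fun_prop

lemma rateFun_lower {q : ℕ} [NeZero q] (hq : 3 ≤ q)
    (hxmin : ∀ y ∈ simplex q,
      ((∀ z ∈ simplex q, freeEnergy q (beta0 q) (h0 q) y ≤ freeEnergy q (beta0 q) (h0 q) z)
        ↔ y = xzero q)) :
    ∃ c > 0, ∀ (y : ℝ) (s : Fin q → ℝ), s 0 = 0 → ∑ k, s k = 0 →
      c * (y ^ 2 * min 1 (y ^ 2) + ∑ k, s k ^ 2) ≤ rateFun q y s := by
  have hq' : (3 : ℝ) ≤ q := by exact_mod_cast hq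
  have hm : 0 < (q : ℝ) - 1 := by linarith
  have hb := beta0_pos hq
  obtain ⟨δ, hδ, hloc⟩ := rateFun_local_lower hq
  set B : ℝ := 8 * (1 + beta0 q) * (1 + beta0 q) with hB
  have hBp : 0 < B := by positivity
  set K : Set (ℝ × (Fin q → ℝ)) := {p | p.1 ^ 2 + ∑ k, p.2 k ^ 2 ≤ B ∧ p.2 0 = 0 ∧
    ∑ k, p.2 k = 0 ∧ (δ ≤ |p.1| ∨ ∃ k, δ ≤ |p.2 k|)} with hK
  have hKc : IsCompact K := by
    refine Metric.isCompact_of_isClosed_isBounded ?_ ?_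
    · have k1 : IsClosed {p : ℝ × (Fin q → ℝ) | p.1 ^ 2 + ∑ k, p.2 k ^ 2 ≤ B} :=
        isClosed_le (by fun_prop) (by fun_prop)
      have k2 : IsClosed {p : ℝ × (Fin q → ℝ) | p.2 0 = 0} :=
        isClosed_eq (by fun_prop) (by fun_prop)
      have k3 : IsClosed {p : ℝ × (Fin q → ℝ) | ∑ k, p.2 k = 0} :=
        isClosed_eq (by fun_prop) (by fun_prop)
      have k4 : IsClosed {p : ℝ × (Fin q → ℝ) | δ ≤ |p.1|} :=
        isClosed_le (by fun_prop) (by fun_prop)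
      have k5 : IsClosed (⋃ k, {p : ℝ × (Fin q → ℝ) | δ ≤ |p.2 k|}) :=
        isClosed_iUnion_of_finite fun k => isClosed_le (by fun_prop) (by fun_prop)
      rw [← Set.ofPred_exists] at k5
      exact k1.inter (k2.inter (k3.inter (k4.union k5)))
    · refine (Metric.isBounded_closedBall (x := 0) (r := √B)).subset ?_
      rintro p ⟨hp, -⟩
      rw [mem_closedBall_zero_iff, Prod.norm_def]
      have hS : 0 ≤ ∑ k, p.2 k ^ 2 := Finset.sum_nonneg fun _ _ => sq_nonneg _
      refine max_le (Real.abs_le_sqrt (by linarith)) ?_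
      rw [pi_norm_le_iff_of_nonneg (Real.sqrt_nonneg _)]
      intro k
      refine Real.abs_le_sqrt ?_
      have := Finset.single_le_sum (f := fun k => p.2 k ^ 2) (fun _ _ => sq_nonneg _)
          (Finset.mem_univ k)
      linarith [sq_nonneg p.1]
  obtain ⟨ε, hε, hKε⟩ : ∃ ε > 0, ∀ p ∈ K, ε ≤ rateFun q p.1 p.2 := by
    rcases K.eq_empty_or_nonempty with h | h
    · exact ⟨1, one_pos, by simp [h]⟩
    · obtain ⟨p, hp, hmin⟩ := hKc.exists_isMinOn h (continuous_rateFun hq).continuousOn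
      refine ⟨_, ?_, fun z hz => hmin hz⟩
      refine rateFun_pos hq hxmin _ hp.2.1 hp.2.2.1 ?_
      rcases hp.2.2.2 with h | ⟨k, h⟩
      · left; intro h'; rw [h', abs_zero] at h; linarith
      · right; intro h'; rw [h', Pi.zero_apply, abs_zero] at h; linarith
  refine ⟨min (min (1 / 24) (1 / (16 * ((q : ℝ) - 1))))
      (min (ε / B) (min (1 / 8) (1 / (8 * beta0 q)))),
    by positivity, fun y s hs0 hs => ?_⟩
  set c := min (min (1 / 24) (1 / (16 * ((q : ℝ) - 1))))
    (min (ε / B) (min (1 / 8) (1 / (8 * beta0 q)))) with hc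
  have hc0 : 0 < c := by positivity
  have c1 : c ≤ 1 / 24 := (min_le_left _ _).trans (min_le_left _ _)
  have c2 : c ≤ 1 / (16 * ((q : ℝ) - 1)) := (min_le_left _ _).trans (min_le_right _ _)
  have c3 : c ≤ ε / B := (min_le_right _ _).trans (min_le_left _ _)
  have c4 : c ≤ 1 / 8 := (min_le_right _ _).trans ((min_le_right _ _).trans (min_le_left _ _))
  have c5 : c ≤ 1 / (8 * beta0 q) :=
    (min_le_right _ _).trans ((min_le_right _ _).trans (min_le_right _ _))
  set S := ∑ k, s k ^ 2 with hSdef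
  have hS : 0 ≤ S := Finset.sum_nonneg fun _ _ => sq_nonneg _
  have hy2 : 0 ≤ y ^ 2 := sq_nonneg y
  have m1 : y ^ 2 * min 1 (y ^ 2) ≤ y ^ 2 := mul_le_of_le_one_right hy2 (min_le_left _ _)
  have m2 : y ^ 2 * min 1 (y ^ 2) ≤ y ^ 4 :=
    (mul_le_mul_of_nonneg_left (min_le_right _ _) hy2).trans_eq (by ring)
  have m0 : 0 ≤ y ^ 2 * min 1 (y ^ 2) := by positivity
  by_cases hA : |y| < δ ∧ ∀ k, |s k| < δ
  · have := hloc y s hs0 hs hA.1 hA.2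
    rw [← hSdef] at this
    have h1 : c * (y ^ 2 * min 1 (y ^ 2)) ≤ 1 / 24 * y ^ 4 :=
      mul_le_mul c1 m2 m0 (by norm_num)
    have h2 : c * S ≤ 1 / (16 * ((q : ℝ) - 1)) * S := mul_le_mul_of_nonneg_right c2 hS
    linarith
  · by_cases hfar : y ^ 2 + S ≤ B
    · have hmem : (y, s) ∈ K := by
        refine ⟨hfar, hs0, hs, ?_⟩
        by_contra! hcon
        exact hA ⟨hcon.1, hcon.2⟩
      have := hKε _ hmem
      have h1 : c * (y ^ 2 * min 1 (y ^ 2) + S) ≤ ε / B * B :=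
        mul_le_mul c3 (by linarith) (by positivity) (by positivity)
      rw [div_mul_cancel₀ _ hBp.ne'] at h1
      exact h1.trans this
    · have hg := rateFun_growth hq y s
      rw [← hSdef] at hg
      have h1 : c * (y ^ 2 * min 1 (y ^ 2)) ≤ 1 / 8 * y ^ 2 :=
        mul_le_mul c4 m1 m0 (by norm_num)
      have h2 : c * S ≤ 1 / (8 * beta0 q) * S := mul_le_mul_of_nonneg_right c5 hS
      have h3 : 1 + beta0 q ≤ 1 / 8 * y ^ 2 + 1 / (8 * beta0 q) * S := by
        push Not at hfar
        have : 1 / 8 * y ^ 2 + 1 / (8 * beta0 q) * S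
          = ((beta0 q) * y ^ 2 + S) / (8 * beta0 q) := by field_simp
        rw [this, le_div_iff₀ (by positivity)]
        have hb1 : 1 ≤ beta0 q := by
          unfold beta0; rw [le_div_iff₀ (by linarith)]; linarith
        nlinarith
      have h4 : S / (4 * beta0 q) = 2 * (1 / (8 * beta0 q) * S) := by field_simp; ring
      rw [h4] at hg
      linarith

lemma tendsto_sq_mul_exp_sub (s : ℝ) :
    Tendsto (fun t : ℝ => t ^ 2 * (Real.exp (s / t) - 1 - s / t)) atTop (𝓝 (s ^ 2 / 2)) := by
  rw [tendsto_iff_dist_tendsto_zero]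
  have hz : Tendsto (fun t : ℝ => |s| ^ 3 / t) atTop (𝓝 0) :=
    tendsto_const_nhds.div_atTop tendsto_id
  refine squeeze_zero' (Eventually.of_forall fun _ => dist_nonneg) ?_ hz
  filter_upwards [eventually_gt_atTop 0, eventually_ge_atTop |s|] with t ht hts
  have h1 : |s / t| ≤ 1 := by
    rw [abs_div, abs_of_pos ht]
    exact div_le_one_of_le₀ hts ht.le
  have h2 := abs_exp_sub_quadratic_le h1
  rw [Real.dist_eq]
  have h3 : t ^ 2 * (Real.exp (s / t) - 1 - s / t) - s ^ 2 / 2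
      = t ^ 2 * (Real.exp (s / t) - 1 - s / t - (s / t) ^ 2 / 2) := by
    field_simp
  rw [h3, abs_mul, abs_of_pos (by positivity)]
  refine (mul_le_mul_of_nonneg_left h2 (by positivity)).trans_eq ?_
  rw [abs_div, abs_of_pos ht]
  field_simp

lemma tendsto_pow_mul_log_one_add {g : ℝ → ℝ} {t : ℝ}
    (hg : Tendsto (fun ρ => ρ ^ 4 * g ρ) atTop (𝓝 t)) :
    Tendsto (fun ρ => ρ ^ 4 * Real.log (1 + g ρ)) atTop (𝓝 t) := by
  have hpow : Tendsto (fun ρ : ℝ => ρ ^ 4) atTop atTop := tendsto_pow_atTop (by norm_num)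
  have hroot : Tendsto (fun x : ℝ => x ^ (1 / 4 : ℝ)) atTop atTop :=
    tendsto_rpow_atTop (by norm_num)
  have hroot4 : ∀ x : ℝ, 0 ≤ x → (x ^ (1 / 4 : ℝ)) ^ 4 = x := by
    intro x hx
    rw [← Real.rpow_natCast, ← Real.rpow_mul hx]; norm_num
  have h := Real.tendsto_mul_log_one_add_of_tendsto (g := fun x => g (x ^ (1 / 4 : ℝ))) (t := t) (by
    refine (hg.comp hroot).congr' ?_
    filter_upwards [eventually_ge_atTop 0] with x hx
    simp only [Function.comp_apply, hroot4 x hx])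
  refine (h.comp hpow).congr' ?_
  filter_upwards [eventually_ge_atTop 0] with ρ hρ
  have : (ρ ^ 4) ^ (1 / 4 : ℝ) = ρ := by
    rw [← Real.rpow_natCast, ← Real.rpow_mul hρ]; norm_num
  simp only [Function.comp_apply, this]

lemma tendsto_pow_mul_rateFun {q : ℕ} [NeZero q] (hq : 3 ≤ q) (x : ℝ) {s : Fin q → ℝ}
    (hs0 : s 0 = 0) (hs : ∑ k, s k = 0) :
    Tendsto (fun ρ : ℝ => ρ ^ 4 * rateFun q (x / ρ) (fun k => s k / ρ ^ 2)) atTop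
      (𝓝 (x ^ 4 / 12 + (1 / (2 * beta0 q) - 1 / (4 * ((q : ℝ) - 1))) * ∑ k, s k ^ 2)) := by
  have hq' : (3 : ℝ) ≤ q := by exact_mod_cast hq
  have hm : (q : ℝ) - 1 ≠ 0 := by linarith
  have hx : Tendsto (fun ρ : ℝ => x / ρ) atTop (𝓝 0) := tendsto_const_nhds.div_atTop tendsto_id
  have h1 : Tendsto (fun ρ : ℝ => ρ ^ 4 * ((x / ρ) ^ 2 / 2 - Real.log (Real.cosh (x / ρ)))) atTop
      (𝓝 (x ^ 4 / 12)) := by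
    by_cases hx0 : x = 0
    · subst hx0; simp
    have hne : Tendsto (fun ρ : ℝ => x / ρ) atTop (𝓝[≠] 0) := by
      rw [tendsto_nhdsWithin_iff]
      refine ⟨hx, ?_⟩
      filter_upwards [eventually_gt_atTop 0] with ρ hρ
      exact div_ne_zero hx0 hρ.ne'
    have := (tendsto_log_cosh_div.comp hne).const_mul (x ^ 4)
    rw [mul_one_div] at this
    refine this.congr' ?_
    filter_upwards [eventually_gt_atTop 0] with ρ hρ
    simp only [Function.comp_apply]
    generalize Real.log (Real.cosh (x / ρ)) = L
    field_simp
  have h2 : Tendsto (fun ρ : ℝ => ρ ^ 4 * Real.log (1 + Real.exp (x / ρ)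
      / (2 * ((q : ℝ) - 1) * Real.cosh (x / ρ))
      * ∑ k, (Real.exp (s k / ρ ^ 2) - 1 - s k / ρ ^ 2))) atTop
      (𝓝 (1 / (4 * ((q : ℝ) - 1)) * ∑ k, s k ^ 2)) := by
    refine tendsto_pow_mul_log_one_add ?_
    have hc : Continuous fun y : ℝ => Real.exp y / (2 * ((q : ℝ) - 1) * Real.cosh y) :=
      Real.continuous_exp.div (by fun_prop) fun y =>
        mul_ne_zero (mul_ne_zero two_ne_zero hm) (Real.cosh_pos y).ne'
    have ht1 := (hc.tendsto 0).comp hx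
    have ht2 : Tendsto (fun ρ : ℝ => ∑ k, (ρ ^ 2) ^ 2
        * (Real.exp (s k / ρ ^ 2) - 1 - s k / ρ ^ 2)) atTop (𝓝 (∑ k, s k ^ 2 / 2)) :=
      tendsto_finsetSum _ fun k _ =>
        (tendsto_sq_mul_exp_sub (s k)).comp (tendsto_pow_atTop two_ne_zero)
    have := ht1.mul ht2
    convert! this using 1
    · ext ρ
      simp only [Function.comp_apply, ← Finset.mul_sum]
      ring
    · simp only [Real.exp_zero, Real.cosh_zero, ← Finset.sum_div]
      congr 1; field_simp; norm_num; ring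
  have h3 : Tendsto (fun ρ : ℝ => ρ ^ 4 * ((∑ k, (s k / ρ ^ 2) ^ 2) / (2 * beta0 q))) atTop
      (𝓝 (1 / (2 * beta0 q) * ∑ k, s k ^ 2)) := by
    refine tendsto_const_nhds.congr' ?_
    filter_upwards [eventually_gt_atTop 0] with ρ hρ
    simp only [div_pow, ← Finset.sum_div]
    field_simp
  have := (h1.add h3).sub h2
  convert! this using 1
  · ext ρ
    have hs' : ∑ k, s k / ρ ^ 2 = 0 := by rw [← Finset.sum_div, hs, zero_div]
    unfold rateFun
    rw [log_siteMGF_eq hq (x / ρ) (by simp [hs0]) hs']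
    ring
  · congr 1; ring

/-- The exponent of the Hubbard–Stratonovich density at scale `ρ = n^{1/4}`: the rescaled rate
function perturbed by the deviation of `(β_n, h_n)` from `(β_0, h_0)`. -/
noncomputable def scaledRate (q : ℕ) [NeZero q] {ι : Type*} [Fintype ι] (e : ι → Fin q → ℝ)
    (ρ η ε : ℝ) (p : ℝ × (ι → ℝ)) : ℝ :=
  ρ ^ 4 * rateFun q (p.1 / ρ) (fun k => (beta0 q * ∑ j, p.2 j * e j k) / ρ ^ 2)
    + η * (ρ ^ 2 * p.1 ^ 2 / 2 + beta0 q * (∑ j, p.2 j ^ 2) / 2) + ε * p.1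

section scaledRate

variable {q : ℕ} [NeZero q] {ι : Type*} [Fintype ι] {e : ι → Fin q → ℝ}

lemma continuous_scaledRate (hq : 3 ≤ q) (e : ι → Fin q → ℝ) (ρ η ε : ℝ) :
    Continuous (scaledRate q e ρ η ε) := by
  have : Continuous fun p : ℝ × (ι → ℝ) =>
      rateFun q (p.1 / ρ) (fun k => (beta0 q * ∑ j, p.2 j * e j k) / ρ ^ 2) :=
    (continuous_rateFun hq).comp (f := fun p : ℝ × (ι → ℝ) =>
      (p.1 / ρ, fun k => (beta0 q * ∑ j, p.2 j * e j k) / ρ ^ 2)) (by fun_prop)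
  unfold scaledRate
  fun_prop

lemma scaledRate_lower [DecidableEq ι] (he : IsTransverseBasis e) (hq : 3 ≤ q)
    (hxmin : ∀ y ∈ simplex q,
      ((∀ z ∈ simplex q, freeEnergy q (beta0 q) (h0 q) y ≤ freeEnergy q (beta0 q) (h0 q) z)
        ↔ y = xzero q)) :
    ∃ c > 0, ∃ C, ∀ ρ η ε : ℝ, 1 ≤ ρ → |η * ρ ^ 2| ≤ c → |η| ≤ c → |ε| ≤ 1 →
      ∀ p : ℝ × (ι → ℝ), c * p.1 ^ 2 + c * ∑ j, p.2 j ^ 2 - C ≤ scaledRate q e ρ η ε p := by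
  have hb := beta0_pos hq
  obtain ⟨c, hc, hlow⟩ := rateFun_lower hq hxmin
  refine ⟨min (c / 2) (min (c * beta0 q / 2) (c * beta0 q ^ 2 / 2)), by positivity, c + 1 / c,
    fun ρ η ε hρ hηρ hη hε p => ?_⟩
  set d := min (c / 2) (min (c * beta0 q / 2) (c * beta0 q ^ 2 / 2)) with hd
  have d1 : d ≤ c / 2 := min_le_left _ _
  have d2 : d ≤ c * beta0 q / 2 := (min_le_right _ _).trans (min_le_left _ _)
  have d3 : d ≤ c * beta0 q ^ 2 / 2 := (min_le_right _ _).trans (min_le_right _ _)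
  have hρ0 : 0 < ρ := by linarith
  set S := ∑ j, p.2 j ^ 2 with hSdef
  have hS : 0 ≤ S := Finset.sum_nonneg fun _ _ => sq_nonneg _
  have hx : 0 ≤ p.1 ^ 2 := sq_nonneg _
  have hcomb : ∑ k, ((beta0 q * ∑ j, p.2 j * e j k) / ρ ^ 2) ^ 2 = beta0 q ^ 2 * S / ρ ^ 4 := by
    rw [hSdef, ← he.sum_sq_combination, Finset.mul_sum, Finset.sum_div]
    exact Finset.sum_congr rfl fun k _ => by field_simp
  have h1 := hlow (p.1 / ρ) (fun k => (beta0 q * ∑ j, p.2 j * e j k) / ρ ^ 2)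
    (by simp [he.combination_zero]) (by
      rw [← Finset.sum_div, ← Finset.mul_sum, he.sum_combination]; simp)
  rw [hcomb] at h1
  have h2 : p.1 ^ 2 - 1 ≤ ρ ^ 4 * ((p.1 / ρ) ^ 2 * min 1 ((p.1 / ρ) ^ 2)) := by
    rcases min_choice 1 ((p.1 / ρ) ^ 2) with h | h
    · rw [h]
      have : ρ ^ 4 * ((p.1 / ρ) ^ 2 * 1) = ρ ^ 2 * p.1 ^ 2 := by field_simp
      rw [this]
      nlinarith [one_le_pow₀ (n := 2) hρ]
    · rw [h]
      have : ρ ^ 4 * ((p.1 / ρ) ^ 2 * (p.1 / ρ) ^ 2) = p.1 ^ 2 * p.1 ^ 2 := by field_simp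
      rw [this]
      nlinarith [sq_nonneg (p.1 ^ 2 - 1)]
  have h3 : c * (p.1 ^ 2 - 1) + c * (beta0 q ^ 2 * S) ≤ ρ ^ 4 * rateFun q (p.1 / ρ)
      (fun k => (beta0 q * ∑ j, p.2 j * e j k) / ρ ^ 2) := by
    have h4 := mul_le_mul_of_nonneg_left h1 (by positivity : 0 ≤ ρ ^ 4)
    have h5 := mul_le_mul_of_nonneg_left h2 hc.le
    have h6 : ρ ^ 4 * (c * ((p.1 / ρ) ^ 2 * min 1 ((p.1 / ρ) ^ 2) + beta0 q ^ 2 * S / ρ ^ 4))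
      = c * (ρ ^ 4 * ((p.1 / ρ) ^ 2 * min 1 ((p.1 / ρ) ^ 2))) + c * (beta0 q ^ 2 * S) := by
      generalize (p.1 / ρ) ^ 2 * min 1 ((p.1 / ρ) ^ 2) = m
      field_simp
    linarith
  have h4 : -(c / 4 * p.1 ^ 2) ≤ η * ρ ^ 2 * p.1 ^ 2 / 2 := by
    nlinarith [(abs_le.1 hηρ).1]
  have h5 : -(c * beta0 q ^ 2 / 4 * S) ≤ η * (beta0 q * S / 2) := by
    have : 0 ≤ beta0 q * S / 2 := by positivity
    nlinarith [(abs_le.1 hη).1]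
  have h6 : -(c / 4 * p.1 ^ 2) - 1 / c ≤ ε * p.1 := by
    have h7 : |ε * p.1| ≤ |p.1| := by
      rw [abs_mul]; exact mul_le_of_le_one_left (abs_nonneg _) hε
    have h8 : |p.1| ≤ c / 4 * p.1 ^ 2 + 1 / c := by
      rw [← sub_nonneg, ← sq_abs p.1]
      have : c / 4 * |p.1| ^ 2 + 1 / c - |p.1| = (c * |p.1| - 2) ^ 2 / (4 * c) := by
        field_simp; ring
      rw [this]; positivity
    linarith [(abs_le.1 h7).1]
  have h7 : d * p.1 ^ 2 ≤ c / 2 * p.1 ^ 2 := mul_le_mul_of_nonneg_right d1 hx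
  have h8 : d * S ≤ c * beta0 q ^ 2 / 2 * S := mul_le_mul_of_nonneg_right d3 hS
  have h9 : 0 ≤ c * beta0 q ^ 2 * S := by positivity
  unfold scaledRate
  rw [← hSdef]
  linarith

lemma tendsto_scaledRate [DecidableEq ι] (he : IsTransverseBasis e) (hq : 3 ≤ q) {ρ η ε : ℕ → ℝ}
    (hρ : Tendsto ρ atTop atTop) (hηρ : Tendsto (fun n => η n * ρ n ^ 2) atTop (𝓝 0))
    (hη : Tendsto η atTop (𝓝 0)) (hε : Tendsto ε atTop (𝓝 0)) (p : ℝ × (ι → ℝ)) :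
    Tendsto (fun n => scaledRate q e (ρ n) (η n) (ε n) p) atTop
      (𝓝 (p.1 ^ 4 / 12 + beta0 q * (1 - 2 / q) / 2 * ∑ j, p.2 j ^ 2)) := by
  have hq' : (3 : ℝ) ≤ q := by exact_mod_cast hq
  have hm : (q : ℝ) - 1 ≠ 0 := by linarith
  have h1 := (tendsto_pow_mul_rateFun hq p.1 (s := fun k => beta0 q * ∑ j, p.2 j * e j k)
    (by simp [he.combination_zero]) (by
      rw [← Finset.mul_sum, he.sum_combination, mul_zero])).comp hρ
  have h2 := ((hηρ.mul_const (p.1 ^ 2 / 2)).add (hη.mul_const (beta0 q * (∑ j, p.2 j ^ 2) / 2))).add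
    (hε.mul_const p.1)
  have := h1.add h2
  convert! this using 1
  · ext n
    simp only [Function.comp_apply, scaledRate]
    ring
  · simp only [mul_pow, ← Finset.mul_sum, he.sum_sq_combination, beta0]
    congr 1
    field_simp
    ring

lemma integrable_exp_neg_sq_add_sum_sq {c : ℝ} (hc : 0 < c) (C : ℝ) :
    Integrable fun p : ℝ × (ι → ℝ) => Real.exp (-(c * p.1 ^ 2 + c * ∑ j, p.2 j ^ 2 - C)) := by
  have h1 : Integrable fun x : ℝ => Real.exp (-c * x ^ 2) := integrable_exp_neg_mul_sq hc
  have h2 : Integrable (fun w : ι → ℝ => ∏ j, Real.exp (-c * w j ^ 2)) volume :=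
    Integrable.fintype_prod (μ := fun _ => volume) fun _ => h1
  have h3 := (h1.mul_prod h2).mul_const (Real.exp C)
  refine h3.congr (Eventually.of_forall fun p => ?_)
  simp only
  rw [← Real.exp_sum, ← Real.exp_add, ← Real.exp_add, ← Finset.mul_sum]
  congr 1; ring

lemma tendsto_integral_scaledRate [DecidableEq ι] (he : IsTransverseBasis e) (hq : 3 ≤ q)
    (hxmin : ∀ y ∈ simplex q,
      ((∀ z ∈ simplex q, freeEnergy q (beta0 q) (h0 q) y ≤ freeEnergy q (beta0 q) (h0 q) z)
        ↔ y = xzero q)) {ρ η ε a : ℕ → ℝ} {b : ℕ → ι → ℝ} {a' : ℝ} {b' : ι → ℝ}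
    (hρ : Tendsto ρ atTop atTop) (hηρ : Tendsto (fun n => η n * ρ n ^ 2) atTop (𝓝 0))
    (hη : Tendsto η atTop (𝓝 0)) (hε : Tendsto ε atTop (𝓝 0)) (ha : Tendsto a atTop (𝓝 a'))
    (hb : Tendsto b atTop (𝓝 b')) :
    Tendsto (fun n => ∫ p : ℝ × (ι → ℝ), Complex.exp ((-scaledRate q e (ρ n) (η n) (ε n) p : ℝ)
        + (a n * p.1 + ∑ j, b n j * p.2 j : ℝ) * Complex.I)) atTop
      (𝓝 (∫ p : ℝ × (ι → ℝ), Complex.exp ((-(p.1 ^ 4 / 12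
        + beta0 q * (1 - 2 / q) / 2 * ∑ j, p.2 j ^ 2) : ℝ)
        + (a' * p.1 + ∑ j, b' j * p.2 j : ℝ) * Complex.I))) := by
  obtain ⟨c, hc, C, hlow⟩ := scaledRate_lower he hq hxmin
  refine tendsto_integral_filter_of_dominated_convergence _ ?_ ?_
    (integrable_exp_neg_sq_add_sum_sq hc C) ?_
  · refine Eventually.of_forall fun n => Continuous.aestronglyMeasurable ?_
    have := continuous_scaledRate hq e (ρ n) (η n) (ε n)
    fun_prop
  · have h1 := hηρ.abs.eventually_lt_const (u := c) (by simpa using hc)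
    have h2 : ∀ᶠ n in atTop, |η n| < c :=
      hη.abs.eventually_lt_const (by simpa using hc)
    have h3 : ∀ᶠ n in atTop, |ε n| < 1 :=
      hε.abs.eventually_lt_const (by simp)
    filter_upwards [h1, h2, h3, hρ.eventually_ge_atTop 1] with n k1 k2 k3 k4
    refine Eventually.of_forall fun p => ?_
    rw [Complex.norm_exp]
    simp only [Complex.add_re, Complex.ofReal_re, Complex.mul_re, Complex.I_re, mul_zero,
      Complex.ofReal_im, Complex.I_im, mul_one, sub_zero, add_zero]
    exact Real.exp_le_exp.2 (neg_le_neg (hlow _ _ _ k4 k1.le k2.le k3.le p))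
  · refine Eventually.of_forall fun p => ?_
    have h1 := (tendsto_scaledRate he hq hρ hηρ hη hε p).neg
    have h2 : Tendsto (fun n => a n * p.1 + ∑ j, b n j * p.2 j) atTop
        (𝓝 (a' * p.1 + ∑ j, b' j * p.2 j)) :=
      (ha.mul_const _).add (tendsto_finsetSum _ fun j _ => (tendsto_pi_nhds.1 hb j).mul_const _)
    exact (Complex.continuous_exp.tendsto _).comp
      (((Complex.continuous_ofReal.tendsto _).comp h1).add
        (((Complex.continuous_ofReal.tendsto _).comp h2).mul_const _))

end scaledRate

lemma sum_comp_eq_sum_colorCount {q n : ℕ} (f : Fin q → ℝ) (σ : Fin n → Fin q) :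
    ∑ i, f (σ i) = ∑ k, f k * colorCount σ k := by
  simp only [colorCount, Finset.card_filter, Nat.cast_sum, Finset.mul_sum]
  rw [Finset.sum_comm]
  exact Finset.sum_congr rfl fun i _ => by simp

lemma sum_colorCount {q n : ℕ} (σ : Fin n → Fin q) : ∑ k, (colorCount σ k : ℝ) = n := by
  simpa using (sum_comp_eq_sum_colorCount (fun _ => 1) σ).symm

lemma sum_lt_ite_eq {q n : ℕ} (σ : Fin n → Fin q) :
    ∑ p ∈ Finset.univ.filter (fun p : Fin n × Fin n => p.1 < p.2),
      (if σ p.1 = σ p.2 then (1 : ℝ) else 0) = (∑ k, (colorCount σ k : ℝ) ^ 2 - n) / 2 := by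
  have h1 : ∑ p : Fin n × Fin n, (if σ p.1 = σ p.2 then (1 : ℝ) else 0)
      = ∑ k, (colorCount σ k : ℝ) ^ 2 := by
    rw [Fintype.sum_prod_type]
    have : ∀ i, ∑ j, (if σ i = σ j then (1 : ℝ) else 0) = colorCount σ (σ i) := by
      intro i
      simp only [colorCount, Finset.card_filter, Nat.cast_sum, eq_comm (a := σ i)]
      simp
    simp only [this]
    rw [sum_comp_eq_sum_colorCount (fun k => (colorCount σ k : ℝ))]
    simp only [sq]
  have h2 : ∑ p ∈ Finset.univ.filter (fun p : Fin n × Fin n => p.2 < p.1),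
      (if σ p.1 = σ p.2 then (1 : ℝ) else 0)
      = ∑ p ∈ Finset.univ.filter (fun p : Fin n × Fin n => p.1 < p.2),
      (if σ p.1 = σ p.2 then (1 : ℝ) else 0) := by
    refine Finset.sum_equiv (Equiv.prodComm _ _) (by simp) fun p _ => ?_
    simp [eq_comm]
  have h3 : ∑ p : Fin n × Fin n, (if p.1 = p.2 then (1 : ℝ) else 0) = n := by
    rw [Fintype.sum_prod_type]; simp
  have h4 : ∑ p : Fin n × Fin n, (if σ p.1 = σ p.2 then (1 : ℝ) else 0)
      = ∑ p : Fin n × Fin n, ((if p.1 < p.2 then (if σ p.1 = σ p.2 then (1 : ℝ) else 0) else 0)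
        + (if p.2 < p.1 then (if σ p.1 = σ p.2 then (1 : ℝ) else 0) else 0)
        + (if p.1 = p.2 then (1 : ℝ) else 0)) := by
    refine Finset.sum_congr rfl fun p _ => ?_
    rcases lt_trichotomy p.1 p.2 with h | h | h
    · simp [h, h.not_gt, h.ne]
    · simp [h]
    · simp [h, h.not_gt, h.ne']
  rw [h1, Finset.sum_add_distrib, Finset.sum_add_distrib, h3] at h4
  simp only [Finset.sum_filter] at h2 ⊢
  rw [h2] at h4
  linarith

/-- The sum of the signs of the spins, which is `n - 2 N_0`. -/
noncomputable def signSum {q n : ℕ} [NeZero q] (σ : Fin n → Fin q) : ℝ := ∑ i, colorSign q (σ i)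

/-- The coordinates of the color counts along the family `e`. -/
noncomputable def transverseSum {q n : ℕ} {ι : Type*} (e : ι → Fin q → ℝ) (σ : Fin n → Fin q)
    (j : ι) : ℝ := ∑ i, e j (σ i)

lemma signSum_eq {q n : ℕ} [NeZero q] (σ : Fin n → Fin q) :
    signSum σ = n - 2 * colorCount σ 0 := by
  have : ∀ k : Fin q, colorSign q k * (colorCount σ k : ℝ)
      = colorCount σ k - (if k = 0 then 2 * (colorCount σ 0 : ℝ) else 0) := by
    intro k
    unfold colorSign
    split_ifs with h
    · subst h; ring
    · ring
  rw [signSum, sum_comp_eq_sum_colorCount]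
  simp [this, Finset.sum_sub_distrib, sum_colorCount]

section

variable {q : ℕ} [NeZero q] {ι : Type*} [Fintype ι] {e : ι → Fin q → ℝ}

/-- Deviation of a color count from the average over the colors other than `0`. -/
noncomputable def countDev {n : ℕ} (σ : Fin n → Fin q) (k : Fin q) : ℝ :=
  if k = 0 then 0 else colorCount σ k - (n - colorCount σ 0) / ((q : ℝ) - 1)

lemma sum_countDev (hq : 2 ≤ q) {n : ℕ} (σ : Fin n → Fin q) : ∑ k, countDev σ k = 0 := by
  have hq' : (2 : ℝ) ≤ q := by exact_mod_cast hq
  have hm : (q : ℝ) - 1 ≠ 0 := by linarith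
  have : ∀ k, countDev σ k = colorCount σ k - (if k = 0 then (colorCount σ 0 : ℝ)
      else (n - colorCount σ 0) / ((q : ℝ) - 1)) := by
    intro k
    unfold countDev
    split_ifs with h
    · subst h; ring
    · rfl
  simp only [this, Finset.sum_sub_distrib, sum_colorCount, sum_ite_eq_zero_else]
  field_simp
  ring

lemma sum_mul_countDev [DecidableEq ι] (he : IsTransverseBasis e) {n : ℕ} (σ : Fin n → Fin q)
    (j : ι) :
    ∑ k, e j k * countDev σ k = transverseSum e σ j := by
  have : ∀ k, e j k * countDev σ k
      = e j k * colorCount σ k - e j k * ((n - colorCount σ 0) / ((q : ℝ) - 1)) := by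
    intro k
    unfold countDev
    split_ifs with h
    · subst h; simp [he.apply_zero]
    · ring
  simp only [this, Finset.sum_sub_distrib, ← Finset.sum_mul, he.sum_eq_zero]
  rw [transverseSum, sum_comp_eq_sum_colorCount]
  ring

lemma countDev_eq [DecidableEq ι] (he : IsTransverseBasis e) (hq : 2 ≤ q) {n : ℕ}
    (σ : Fin n → Fin q)
    (k : Fin q) : countDev σ k = ∑ j, transverseSum e σ j * e j k := by
  rw [he.expand (countDev σ) (by simp [countDev]) (sum_countDev hq σ) k]
  simp only [sum_mul_countDev he]

lemma sum_sq_colorCount [DecidableEq ι] (he : IsTransverseBasis e) (hq : 2 ≤ q) {n : ℕ}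
    (σ : Fin n → Fin q) :
    ∑ k, (colorCount σ k : ℝ) ^ 2 = (n - signSum σ) ^ 2 / 4
      + (n + signSum σ) ^ 2 / (4 * ((q : ℝ) - 1)) + ∑ j, transverseSum e σ j ^ 2 := by
  have hq' : (2 : ℝ) ≤ q := by exact_mod_cast hq
  have hm : (q : ℝ) - 1 ≠ 0 := by linarith
  have h1 := he.sum_sq_eq (v := countDev σ) (by simp [countDev]) (sum_countDev hq σ)
  simp only [sum_mul_countDev he] at h1
  rw [← h1]
  set c : ℝ := (n - colorCount σ 0) / ((q : ℝ) - 1) with hc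
  have : ∀ k, (colorCount σ k : ℝ) ^ 2 = countDev σ k ^ 2 + 2 * c * countDev σ k
      + (if k = 0 then (colorCount σ 0 : ℝ) ^ 2 else c ^ 2) := by
    intro k
    unfold countDev
    split_ifs with h
    · subst h; ring
    · rw [← hc]; ring
  rw [Finset.sum_congr rfl fun k _ => this k]
  simp only [Finset.sum_add_distrib, ← Finset.mul_sum, sum_countDev hq,
    sum_ite_eq_zero_else, signSum_eq]
  rw [hc]
  field_simp
  ring

lemma prod_xzero (hq : 3 ≤ q) {n : ℕ} (σ : Fin n → Fin q) :
    ∏ i, xzero q (σ i) = Real.exp (-(n * Real.log 2) - n * Real.log ((q : ℝ) - 1) / 2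
      - Real.log ((q : ℝ) - 1) / 2 * signSum σ) := by
  have hq' : (3 : ℝ) ≤ q := by exact_mod_cast hq
  have hm : 0 < (q : ℝ) - 1 := by linarith
  have : ∀ k, xzero q k = Real.exp (-Real.log 2 - Real.log ((q : ℝ) - 1) / 2
      - Real.log ((q : ℝ) - 1) / 2 * colorSign q k) := by
    intro k
    unfold xzero colorSign
    split_ifs
    · have : -Real.log 2 - Real.log ((q : ℝ) - 1) / 2 - Real.log ((q : ℝ) - 1) / 2 * -1
        = -Real.log 2 := by ring
      rw [this, Real.exp_neg, Real.exp_log two_pos, one_div]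
    · have : -Real.log 2 - Real.log ((q : ℝ) - 1) / 2 - Real.log ((q : ℝ) - 1) / 2 * 1
        = -(Real.log 2 + Real.log ((q : ℝ) - 1)) := by ring
      rw [this, Real.exp_neg, Real.exp_add, Real.exp_log two_pos, Real.exp_log hm, one_div]
  simp only [this]
  rw [← Real.exp_sum]
  congr 1
  simp only [signSum, Finset.sum_sub_distrib, Finset.sum_const, Finset.card_univ,
    Fintype.card_fin, nsmul_eq_mul, ← Finset.mul_sum]
  ring

/-- The shift of the external field felt by the sign magnetization away from `(β_0, h_0)`. -/
noncomputable def fieldShift (q : ℕ) (β h : ℝ) : ℝ :=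
  (β - beta0 q) * (1 - 1 / ((q : ℝ) - 1)) / 4 + (h - h0 q) / 2

lemma cwWeight_eq [DecidableEq ι] (he : IsTransverseBasis e) (hq : 3 ≤ q) {n : ℕ} (hn : n ≠ 0)
    {ρ : ℝ}
    (hρ : 0 < ρ) (hρn : ρ ^ 4 = n) (β h : ℝ) :
    ∃ C > 0, ∀ σ : Fin n → Fin q, cwWeight q n β h σ = C * ((∏ i, xzero q (σ i))
      * Real.exp (β / beta0 q * ρ ^ 2 * (signSum σ / ρ ^ 3) ^ 2 / 2
        + β * (∑ j, (transverseSum e σ j / ρ ^ 2) ^ 2) / 2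
        - ρ ^ 3 * fieldShift q β h * (signSum σ / ρ ^ 3))) := by
  have hq' : (3 : ℝ) ≤ q := by exact_mod_cast hq
  have hm : 0 < (q : ℝ) - 1 := by linarith
  have hn' : (n : ℝ) ≠ 0 := by exact_mod_cast hn
  refine ⟨Real.exp (β * n * (1 + 1 / ((q : ℝ) - 1)) / 8 - β / 2 + h * n / 2 + n * Real.log 2
    + n * Real.log ((q : ℝ) - 1) / 2), Real.exp_pos _, fun σ => ?_⟩
  have hc : (∑ i, (if σ i = 0 then (1 : ℝ) else 0)) = (n - signSum σ) / 2 := by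
    rw [signSum_eq, colorCount, Finset.card_filter]
    push_cast; ring
  rw [cwWeight, sum_lt_ite_eq, hc, sum_sq_colorCount he (by omega), prod_xzero hq,
    ← Real.exp_add, ← Real.exp_add]
  congr 1
  simp only [div_pow, ← Finset.sum_div, fieldShift]
  have hb' : beta0 q = 4 * ((q : ℝ) - 1) / q := rfl
  have hh' : h0 q = Real.log ((q : ℝ) - 1) - 2 * ((q : ℝ) - 2) / q := rfl
  rw [hh', hb']
  generalize ∑ j, transverseSum e σ j ^ 2 = A
  generalize signSum σ = M
  generalize Real.log ((q : ℝ) - 1) = L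
  have hq0 : (q : ℝ) ≠ 0 := by linarith
  rw [← hρn]
  field_simp
  ring

end

lemma Tstat_eq {q n : ℕ} [NeZero q] (hq : 2 ≤ q) (σ : Fin n → Fin q) :
    Tstat q n σ = signSum σ / (n : ℝ) ^ ((3 : ℝ) / 4) / (2 * ((q : ℝ) - 1)) := by
  have hq' : (2 : ℝ) ≤ q := by exact_mod_cast hq
  have hm : (q : ℝ) - 1 ≠ 0 := by linarith
  have hq0 : (q : ℝ) ≠ 0 := by linarith
  have h1 : ∑ k, uvec q k ^ 2 = q * ((q : ℝ) - 1) := by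
    simp only [uvec, ite_pow, sum_ite_eq_zero_else]; ring
  have h2 : ∀ k, ((colorCount σ k : ℝ) - n * xzero q k) * uvec q k
      = colorCount σ k + (if k = 0 then -(q : ℝ) * colorCount σ 0 - n / 2 * (1 - q)
        else -(n / (2 * ((q : ℝ) - 1)))) := by
    intro k
    unfold xzero uvec
    split_ifs with h
    · subst h; ring
    · ring
  simp only [Tstat, h1, h2, Finset.sum_add_distrib, sum_colorCount]
  have h3 : (n : ℝ) + (-(q : ℝ) * colorCount σ 0 - n / 2 * (1 - q)
      + ((q : ℝ) - 1) * -(n / (2 * ((q : ℝ) - 1)))) = q * (n - 2 * colorCount σ 0) / 2 := by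
    field_simp; ring
  rw [sum_ite_eq_zero_else, signSum_eq, h3]
  generalize (n : ℝ) ^ ((3 : ℝ) / 4) = R
  field_simp

lemma Vstat_eq {q n : ℕ} [NeZero q] (hq : 2 ≤ q) (hn : n ≠ 0) (σ : Fin n → Fin q) :
    Vstat q n σ = fun k => countDev σ k / (n : ℝ) ^ ((1 : ℝ) / 2) := by
  have hq' : (2 : ℝ) ≤ q := by exact_mod_cast hq
  have hm : (q : ℝ) - 1 ≠ 0 := by linarith
  have hn' : (n : ℝ) ^ ((3 : ℝ) / 4) ≠ 0 := by positivity
  ext k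
  rw [Vstat, Tstat_eq hq]
  congr 1
  have : (n : ℝ) ^ ((3 : ℝ) / 4) * (signSum σ / (n : ℝ) ^ ((3 : ℝ) / 4) / (2 * ((q : ℝ) - 1)))
      = signSum σ / (2 * ((q : ℝ) - 1)) := by field_simp
  rw [this, signSum_eq]
  unfold countDev xzero uvec
  split_ifs with h
  · subst h; field_simp; ring
  · field_simp; ring

section

variable {q : ℕ} [NeZero q] {ι : Type*} [Fintype ι] {e : ι → Fin q → ℝ}

lemma exp_neg_mul_rateFun (hq : 3 ≤ q) (n : ℕ) (y : ℝ) (s : Fin q → ℝ) :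
    Real.exp (-(n * rateFun q y s)) = ∑ σ : Fin n → Fin q, (∏ i, xzero q (σ i))
      * Real.exp (y * signSum σ + ∑ i, s (σ i) - n * (y ^ 2 / 2)
        - n * ((∑ k, s k ^ 2) / (2 * beta0 q))) := by
  have h : Real.exp (-(n * rateFun q y s)) = siteMGF q y s ^ n * Real.exp (- n * (y ^ 2 / 2)
        - n * ((∑ k, s k ^ 2) / (2 * beta0 q))) := by
    rw [← Real.exp_log (pow_pos (siteMGF_pos hq y s) n), ← Real.exp_add, Real.log_pow, rateFun]
    congr 1; ring
  rw [h, siteMGF, Fintype.sum_pow, Finset.sum_mul]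
  refine Finset.sum_congr rfl fun σ _ => ?_
  rw [Finset.prod_mul_distrib, mul_assoc, ← Real.exp_sum, ← Real.exp_add, Finset.sum_add_distrib,
    ← Finset.mul_sum, signSum]
  congr 2; ring

lemma exp_neg_scaledRate [DecidableEq ι] (he : IsTransverseBasis e) (hq : 3 ≤ q) {n : ℕ} {ρ : ℝ}
    (hρ : 0 < ρ) (hρn : ρ ^ 4 = n) (η ε : ℝ) (p : ℝ × (ι → ℝ)) :
    Real.exp (-scaledRate q e ρ η ε p) = ∑ σ : Fin n → Fin q, (∏ i, xzero q (σ i))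
      * Real.exp (-((1 + η) * ρ ^ 2 / 2) * p.1 ^ 2 + (ρ ^ 2 * (signSum σ / ρ ^ 3) - ε) * p.1
        + (-((1 + η) * beta0 q / 2) * ∑ j, p.2 j ^ 2
          + ∑ j, beta0 q * (transverseSum e σ j / ρ ^ 2) * p.2 j)) := by
  have hb := (beta0_pos hq).ne'
  have hsq : ∑ k, ((beta0 q * ∑ j, p.2 j * e j k) / ρ ^ 2) ^ 2
      = beta0 q ^ 2 * (∑ j, p.2 j ^ 2) / ρ ^ 4 := by
    rw [← he.sum_sq_combination, Finset.mul_sum, Finset.sum_div]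
    exact Finset.sum_congr rfl fun k _ => by field_simp
  have hlin : ∀ σ : Fin n → Fin q, ∑ i, (beta0 q * ∑ j, p.2 j * e j (σ i)) / ρ ^ 2
      = ∑ j, beta0 q * (transverseSum e σ j / ρ ^ 2) * p.2 j := by
    intro σ
    simp only [transverseSum, Finset.mul_sum, Finset.sum_div, Finset.sum_mul]
    rw [Finset.sum_comm]
    exact Finset.sum_congr rfl fun i _ => Finset.sum_congr rfl fun j _ => by ring
  unfold scaledRate
  rw [hρn, neg_add, neg_add, add_assoc, Real.exp_add, exp_neg_mul_rateFun hq, Finset.sum_mul]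
  refine Finset.sum_congr rfl fun σ _ => ?_
  rw [mul_assoc, ← Real.exp_add, hsq, hlin, ← hρn]
  congr 2
  generalize ∑ j, p.2 j ^ 2 = S
  field_simp
  ring

/-- The Gaussian integral underlying the Hubbard–Stratonovich transform. -/
lemma integral_cexp_prod_quadratic {A B : ℝ} (hA : 0 < A) (hB : 0 < B) (c : ℂ) (d : ι → ℂ) :
    Integrable (fun p : ℝ × (ι → ℝ) => Complex.exp (-A * p.1 ^ 2 + c * p.1
      + (-B * ∑ j, (p.2 j : ℂ) ^ 2 + ∑ j, d j * p.2 j))) ∧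
    ∫ p : ℝ × (ι → ℝ), Complex.exp (-A * p.1 ^ 2 + c * p.1
      + (-B * ∑ j, (p.2 j : ℂ) ^ 2 + ∑ j, d j * p.2 j))
      = (π / A : ℂ) ^ (1 / 2 : ℂ) * (π / B : ℂ) ^ (Fintype.card ι / 2 : ℂ)
        * Complex.exp (c ^ 2 / (4 * A) + (∑ j, d j ^ 2) / (4 * B)) := by
  have h1 : Integrable fun x : ℝ => Complex.exp (-A * x ^ 2 + c * x) := by
    simpa using integrable_cexp_quadratic (b := A) (by simpa using hA) c 0
  have h2 : Integrable fun w : ι → ℝ =>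
      Complex.exp (-B * ∑ j, (w j : ℂ) ^ 2 + ∑ j, d j * w j) :=
    GaussianFourier.integrable_cexp_neg_mul_sum_add (by simpa using hB) d
  have h3 := integral_cexp_quadratic (b := -A) (by simpa using hA) c 0
  have h4 := GaussianFourier.integral_cexp_neg_mul_sum_add (b := B) (by simpa using hB) d
  simp only [add_zero, zero_sub, neg_neg, mul_neg, div_neg] at h3
  simp only [Complex.exp_add (_ + _) (_ + _)]
  refine ⟨h1.mul_prod h2, ?_⟩
  rw [Measure.volume_eq_prod, integral_prod_mul (f := fun x : ℝ => Complex.exp (-A * x ^ 2 + c * x))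
    (g := fun w : ι → ℝ => Complex.exp (-B * ∑ j, (w j : ℂ) ^ 2 + ∑ j, d j * w j)),
    h3, h4, Complex.exp_add]
  ring

lemma integral_scaledRate_eq [DecidableEq ι] (he : IsTransverseBasis e) (hq : 3 ≤ q) {n : ℕ}
    {ρ : ℝ} (hρ : 0 < ρ) (hρn : ρ ^ 4 = n) {r : ℝ} (hr : 0 < r) (δ : ℝ) :
    ∃ G : ℂ, G ≠ 0 ∧ ∀ (a : ℝ) (b : ι → ℝ),
      ∫ p : ℝ × (ι → ℝ), Complex.exp ((-scaledRate q e ρ (1 / r - 1) (δ / r) p : ℝ)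
        + (a / r * p.1 + ∑ j, b j / r * p.2 j : ℝ) * Complex.I)
      = G * Complex.exp ((a * Complex.I - δ) ^ 2 / (2 * r * ρ ^ 2)
          - (∑ j, b j ^ 2 : ℝ) / (2 * r * beta0 q))
        * ∑ σ : Fin n → Fin q, (((∏ i, xzero q (σ i))
          * Real.exp (r * ρ ^ 2 * (signSum σ / ρ ^ 3) ^ 2 / 2
          + r * beta0 q * (∑ j, (transverseSum e σ j / ρ ^ 2) ^ 2) / 2
          - δ * (signSum σ / ρ ^ 3)) : ℝ) : ℂ)
          * Complex.exp ((a * (signSum σ / ρ ^ 3) + ∑ j, b j * (transverseSum e σ j / ρ ^ 2) : ℝ)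
            * Complex.I) := by
  have hb := beta0_pos hq
  set A : ℝ := ρ ^ 2 / (2 * r) with hA
  set B : ℝ := beta0 q / (2 * r) with hB
  have hAp : 0 < A := by positivity
  have hBp : 0 < B := by positivity
  have hπA : (π / A : ℂ) ≠ 0 := by
    have : (A : ℂ) ≠ 0 := by exact_mod_cast hAp.ne'
    have : (π : ℂ) ≠ 0 := by exact_mod_cast Real.pi_ne_zero
    positivity
  have hπB : (π / B : ℂ) ≠ 0 := by
    have : (B : ℂ) ≠ 0 := by exact_mod_cast hBp.ne'
    have : (π : ℂ) ≠ 0 := by exact_mod_cast Real.pi_ne_zero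
    positivity
  refine ⟨(π / A : ℂ) ^ (1 / 2 : ℂ) * (π / B : ℂ) ^ (Fintype.card ι / 2 : ℂ),
    mul_ne_zero (by simp [Complex.cpow_eq_zero_iff, hπA]) (by simp [Complex.cpow_eq_zero_iff, hπB]),
    fun a b => ?_⟩
  have hgauss := fun σ : Fin n → Fin q => integral_cexp_prod_quadratic hAp hBp
    ((ρ ^ 2 * (signSum σ / ρ ^ 3) - δ / r : ℝ) + (a / r : ℝ) * Complex.I)
    (fun j : ι => (beta0 q * (transverseSum e σ j / ρ ^ 2) : ℝ) + (b j / r : ℝ) * Complex.I)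
  have hint : ∀ p : ℝ × (ι → ℝ),
      Complex.exp ((-scaledRate q e ρ (1 / r - 1) (δ / r) p : ℝ)
        + (a / r * p.1 + ∑ j, b j / r * p.2 j : ℝ) * Complex.I)
      = ∑ σ : Fin n → Fin q, ((∏ i, xzero q (σ i) : ℝ) : ℂ) * Complex.exp (-A * p.1 ^ 2
        + ((ρ ^ 2 * (signSum σ / ρ ^ 3) - δ / r : ℝ) + (a / r : ℝ) * Complex.I) * p.1
        + (-B * ∑ j, (p.2 j : ℂ) ^ 2
        + ∑ j, ((beta0 q * (transverseSum e σ j / ρ ^ 2) : ℝ) + (b j / r : ℝ) * Complex.I)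
          * p.2 j)) := by
    intro p
    rw [Complex.exp_add, ← Complex.ofReal_exp, exp_neg_scaledRate he hq hρ hρn, Complex.ofReal_sum,
      Finset.sum_mul]
    refine Finset.sum_congr rfl fun σ _ => ?_
    rw [Complex.ofReal_mul, Complex.ofReal_exp, mul_assoc, ← Complex.exp_add]
    congr 2
    have e1 : (1 + (1 / r - 1)) * ρ ^ 2 / 2 = A := by rw [hA]; field_simp; ring
    have e2 : (1 + (1 / r - 1)) * beta0 q / 2 = B := by rw [hB]; field_simp; ring
    rw [e1, e2]
    simp only [add_mul, Finset.sum_add_distrib]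
    push_cast
    simp only [add_mul, Finset.sum_mul]
    have : ∑ j, (b j : ℂ) / r * p.2 j * Complex.I = ∑ j, (b j : ℂ) / r * Complex.I * p.2 j :=
      Finset.sum_congr rfl fun j _ => by ring
    rw [this]
    ring
  simp only [hint]
  rw [integral_finsetSum _ fun σ _ => (hgauss σ).1.const_mul _, Finset.mul_sum]
  refine Finset.sum_congr rfl fun σ _ => ?_
  rw [integral_const_mul, (hgauss σ).2, Complex.ofReal_mul, Complex.ofReal_exp]
  have key : ((ρ ^ 2 * (signSum σ / ρ ^ 3) - δ / r : ℝ) + (a / r : ℝ) * Complex.I) ^ 2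
        / (4 * A : ℂ)
      + (∑ j, ((beta0 q * (transverseSum e σ j / ρ ^ 2) : ℝ) + (b j / r : ℝ) * Complex.I) ^ 2)
        / (4 * B)
      = ((a * Complex.I - δ) ^ 2 / (2 * r * ρ ^ 2)
          - (∑ j, b j ^ 2 : ℝ) / (2 * r * beta0 q))
        + (((r * ρ ^ 2 * (signSum σ / ρ ^ 3) ^ 2 / 2
          + r * beta0 q * (∑ j, (transverseSum e σ j / ρ ^ 2) ^ 2) / 2
          - δ * (signSum σ / ρ ^ 3) : ℝ) : ℂ)
        + (a * (signSum σ / ρ ^ 3) + ∑ j, b j * (transverseSum e σ j / ρ ^ 2) : ℝ)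
            * Complex.I) := by
    have hr' : (r : ℂ) ≠ 0 := by exact_mod_cast hr.ne'
    have hb' : (beta0 q : ℂ) ≠ 0 := by exact_mod_cast hb.ne'
    have hρ' : (ρ : ℂ) ≠ 0 := by exact_mod_cast hρ.ne'
    have hsum : ∑ j, (((beta0 q * (transverseSum e σ j / ρ ^ 2) : ℝ) : ℂ)
        + (b j / r : ℝ) * Complex.I) ^ 2
        = (beta0 q : ℂ) ^ 2 * ((∑ j, (transverseSum e σ j / ρ ^ 2) ^ 2 : ℝ) : ℂ)
          + 2 * beta0 q / r * ((∑ j, b j * (transverseSum e σ j / ρ ^ 2) : ℝ) : ℂ) * Complex.I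
          - ((∑ j, b j ^ 2 : ℝ) : ℂ) / r ^ 2 := by
      push_cast
      simp only [Finset.mul_sum, Finset.sum_mul, Finset.sum_div]
      rw [← Finset.sum_add_distrib, ← Finset.sum_sub_distrib]
      refine Finset.sum_congr rfl fun j _ => ?_
      field_simp
      linear_combination (b j : ℂ) ^ 2 * ρ ^ 4 * Complex.I_sq
    rw [hsum, hA, hB]
    push_cast
    generalize ∑ j, (b j : ℂ) ^ 2 = S1
    generalize ∑ j, (b j : ℂ) * (transverseSum e σ j / ρ ^ 2) = S2
    generalize ∑ j, ((transverseSum e σ j : ℂ) / ρ ^ 2) ^ 2 = S3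
    field_simp
    ring
  rw [key, Complex.exp_add, Complex.exp_add]
  ring

end

lemma cwZ_pos (q n : ℕ) [NeZero q] (β h : ℝ) : 0 < cwZ q n β h :=
  Finset.sum_pos (fun _ _ => Real.exp_pos _) ⟨fun _ => 0, Finset.mem_univ _⟩

lemma mul_div_mul_eq_of_mul_eq {C G D E E' S Z : ℂ} (hC : C ≠ 0) (hG : G ≠ 0) (hD : D ≠ 0)
    (hZ : Z ≠ 0) (h : E * E' = D) : C * S / (C * Z) = E * (G * E' * S) / (G * D * Z) := by
  rw [div_eq_div_iff (mul_ne_zero hC hZ) (mul_ne_zero (mul_ne_zero hG hD) hZ), ← h]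
  ring

section

variable {q : ℕ} [NeZero q] {ι : Type*} [Fintype ι] {e : ι → Fin q → ℝ}

lemma charFun_eq_div [DecidableEq ι] (he : IsTransverseBasis e) (hq : 3 ≤ q) {n : ℕ} (hn : n ≠ 0)
    {ρ : ℝ} (hρ : 0 < ρ) (hρn : ρ ^ 4 = n) {β : ℝ} (hβ : 0 < β) (h a : ℝ) (b : ι → ℝ)
    {r δ : ℝ} (hr : r = β / beta0 q) (hδ : δ = ρ ^ 3 * fieldShift q β h) :
    (∑ σ : Fin n → Fin q, (cwWeight q n β h σ : ℂ)
      * Complex.exp ((a * (signSum σ / ρ ^ 3) + ∑ j, b j * (transverseSum e σ j / ρ ^ 2) : ℝ)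
        * Complex.I)) / cwZ q n β h
      = Complex.exp (((∑ j, b j ^ 2 : ℝ) : ℂ) / (2 * r * beta0 q)
          - ((a * Complex.I - δ) ^ 2 - δ ^ 2) / (2 * r * ρ ^ 2))
        * (∫ p : ℝ × (ι → ℝ), Complex.exp ((-scaledRate q e ρ (1 / r - 1) (δ / r) p : ℝ)
        + (a / r * p.1 + ∑ j, b j / r * p.2 j : ℝ) * Complex.I))
        / (∫ p : ℝ × (ι → ℝ), Complex.exp ((-scaledRate q e ρ (1 / r - 1) (δ / r) p : ℝ)
        + ((0 : ℝ) * p.1 + ∑ j, (0 : ι → ℝ) j * p.2 j : ℝ) * Complex.I)) := by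
  have hb := beta0_pos hq
  have hr0 : 0 < r := by rw [hr]; positivity
  obtain ⟨C, hC, hw⟩ := cwWeight_eq he hq hn hρ hρn β h
  obtain ⟨G, hG, hJ⟩ := integral_scaledRate_eq he hq hρ hρn hr0 δ
  have hrb : r * beta0 q = β := by rw [hr]; field_simp
  rw [← hδ, ← hr] at hw
  simp only [hrb] at hJ
  have hC' : (C : ℂ) ≠ 0 := by exact_mod_cast hC.ne'
  set W : (Fin n → Fin q) → ℝ := fun σ => (∏ i, xzero q (σ i))
      * Real.exp (r * ρ ^ 2 * (signSum σ / ρ ^ 3) ^ 2 / 2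
        + β * (∑ j, (transverseSum e σ j / ρ ^ 2) ^ 2) / 2
        - δ * (signSum σ / ρ ^ 3)) with hW
  have hw' : ∀ σ, (cwWeight q n β h σ : ℂ) = C * W σ := by
    intro σ
    rw [hw σ, Complex.ofReal_mul]
  have hZ : (cwZ q n β h : ℂ) = C * ∑ σ, (W σ : ℂ) := by
    rw [cwZ, Complex.ofReal_sum, Finset.mul_sum]
    exact Finset.sum_congr rfl fun σ _ => hw' σ
  have hZ0 : (∑ σ, (W σ : ℂ)) ≠ 0 := by
    intro hW0
    rw [hW0, mul_zero] at hZ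
    exact (cwZ_pos q n β h).ne' (by exact_mod_cast hZ)
  have hJ0 := hJ 0 0
  simp only [zero_div, Pi.zero_apply, zero_mul, Finset.sum_const_zero, add_zero,
    Complex.ofReal_zero, Complex.exp_zero, mul_one, zero_sub, ne_eq, OfNat.ofNat_ne_zero,
    not_false_eq_true, zero_pow, sub_zero, neg_sq] at hJ0
  simp only [Pi.zero_apply, zero_mul, Finset.sum_const_zero, add_zero, Complex.ofReal_zero]
  rw [hJ a b, hJ0, hZ, Finset.sum_congr rfl fun σ _ => by rw [hw' σ, mul_assoc], ← Finset.mul_sum]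
  have hexp : Complex.exp (((∑ j, b j ^ 2 : ℝ) : ℂ) / (2 * r * beta0 q)
          - ((a * Complex.I - δ) ^ 2 - δ ^ 2) / (2 * r * ρ ^ 2))
      * Complex.exp ((a * Complex.I - δ) ^ 2 / (2 * r * ρ ^ 2)
          - (∑ j, b j ^ 2 : ℝ) / (2 * r * beta0 q)) = Complex.exp (δ ^ 2 / (2 * r * ρ ^ 2)) := by
    rw [← Complex.exp_add]; congr 1; ring
  have hne := Complex.exp_ne_zero ((δ : ℂ) ^ 2 / (2 * r * ρ ^ 2))
  exact mul_div_mul_eq_of_mul_eq hC' hG hne hZ0 hexp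

/-- The quartic Gaussian Fourier integral of the limit law. -/
noncomputable def quarticFourier (a : ℝ) : ℂ :=
  ∫ x : ℝ, Complex.exp (-(x ^ 4 / 12 : ℝ) + (a * x : ℝ) * Complex.I)

lemma integrable_exp_neg_mul_pow_four {k : ℝ} (hk : 0 < k) :
    Integrable fun x : ℝ => Real.exp (-k * x ^ 4) := by
  refine ((integrable_exp_neg_mul_sq hk).const_mul (Real.exp k)).mono'
    (Continuous.aestronglyMeasurable (by fun_prop)) (Eventually.of_forall fun x => ?_)
  rw [Real.norm_eq_abs, Real.abs_exp, ← Real.exp_add, Real.exp_le_exp]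
  nlinarith [sq_nonneg (x ^ 2 - 1), sq_nonneg x]

lemma quarticFourier_zero_ne_zero : quarticFourier 0 ≠ 0 := by
  have h : quarticFourier 0 = ((∫ x : ℝ, Real.exp (-(1 / 12) * x ^ 4) : ℝ) : ℂ) := by
    rw [quarticFourier, ← integral_complex_ofReal]
    congr 1
    ext x
    push_cast
    congr 1; ring
  rw [h]
  have := integral_exp_pos (integrable_exp_neg_mul_pow_four (k := 1 / 12) (by norm_num))
  exact_mod_cast this.ne'

lemma integral_limit_eq {γ : ℝ} (hγ : 0 < γ) (a : ℝ) (b : ι → ℝ) :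
    ∫ p : ℝ × (ι → ℝ), Complex.exp ((-(p.1 ^ 4 / 12 + γ / 2 * ∑ j, p.2 j ^ 2) : ℝ)
        + (a * p.1 + ∑ j, b j * p.2 j : ℝ) * Complex.I)
      = quarticFourier a * (π / (γ / 2 : ℝ) : ℂ) ^ (Fintype.card ι / 2 : ℂ)
        * Complex.exp (-(∑ j, b j ^ 2 : ℝ) / (2 * γ)) := by
  have h4 := GaussianFourier.integral_cexp_neg_mul_sum_add (b := ((γ / 2 : ℝ) : ℂ))
    (by rw [Complex.ofReal_re]; positivity) (fun j : ι => b j * Complex.I)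
  have h5 : ∀ p : ℝ × (ι → ℝ), Complex.exp ((-(p.1 ^ 4 / 12 + γ / 2 * ∑ j, p.2 j ^ 2) : ℝ)
        + (a * p.1 + ∑ j, b j * p.2 j : ℝ) * Complex.I)
      = Complex.exp (-(p.1 ^ 4 / 12 : ℝ) + (a * p.1 : ℝ) * Complex.I)
        * Complex.exp (-((γ / 2 : ℝ) : ℂ) * ∑ j, (p.2 j : ℂ) ^ 2
          + ∑ j, b j * Complex.I * p.2 j) := by
    intro p
    rw [← Complex.exp_add]
    congr 1
    push_cast
    have : ∑ j, (b j : ℂ) * Complex.I * p.2 j = (∑ j, (b j : ℂ) * p.2 j) * Complex.I := by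
      rw [Finset.sum_mul]
      exact Finset.sum_congr rfl fun j _ => by ring
    rw [this]; ring
  simp only [h5]
  rw [Measure.volume_eq_prod,
    integral_prod_mul (f := fun x : ℝ => Complex.exp (-(x ^ 4 / 12 : ℝ) + (a * x : ℝ) * Complex.I))
    (g := fun w : ι → ℝ => Complex.exp (-((γ / 2 : ℝ) : ℂ) * ∑ j, (w j : ℂ) ^ 2
          + ∑ j, b j * Complex.I * w j)), h4, quarticFourier]
  have h6 : (∑ j, ((b j : ℂ) * Complex.I) ^ 2) / (4 * ((γ / 2 : ℝ) : ℂ))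
      = -(∑ j, b j ^ 2 : ℝ) / (2 * γ) := by
    simp only [mul_pow, Complex.I_sq, ← Finset.sum_mul]
    push_cast
    have : (γ : ℂ) ≠ 0 := by exact_mod_cast hγ.ne'
    field_simp
    ring
  rw [h6]
  ring

end

lemma rpow_quarter_pow (n : ℕ) :
    ((n : ℝ) ^ ((1 : ℝ) / 4)) ^ 4 = n ∧
      ((n : ℝ) ^ ((1 : ℝ) / 4)) ^ 3 = (n : ℝ) ^ ((3 : ℝ) / 4) ∧
      ((n : ℝ) ^ ((1 : ℝ) / 4)) ^ 2 = (n : ℝ) ^ ((1 : ℝ) / 2) := by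
  have h : (0 : ℝ) ≤ n := Nat.cast_nonneg n
  refine ⟨?_, ?_, ?_⟩ <;> rw [← Real.rpow_natCast, ← Real.rpow_mul h] <;> norm_num

lemma beta0_mul_sub_pos {q : ℕ} (hq : 3 ≤ q) : 0 < beta0 q * (1 - 2 / q) := by
  have h3 : (3 : ℝ) ≤ q := by exact_mod_cast hq
  have h : 2 / (q : ℝ) < 1 := by rw [div_lt_one (by linarith)]; linarith
  exact mul_pos (beta0_pos hq) (by linarith)

lemma inv_sub_inv_beta0 {q : ℕ} (hq : 3 ≤ q) :
    1 / (2 * (beta0 q * (1 - 2 / q))) - 1 / (2 * beta0 q)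
      = (q : ℝ) / (2 * ((q : ℝ) - 1) * ((q : ℝ) - 2)) / 2 := by
  have h3 : (3 : ℝ) ≤ q := by exact_mod_cast hq
  have h0 : (q : ℝ) ≠ 0 := by linarith
  have h1 : (q : ℝ) - 1 ≠ 0 := by linarith
  have h2 : (q : ℝ) - 2 ≠ 0 := by linarith
  rw [beta0]
  field_simp
  ring

section

variable {q : ℕ} [NeZero q] {ι : Type*} [Fintype ι] [DecidableEq ι] {e : ι → Fin q → ℝ}

lemma tendsto_charFun (he : IsTransverseBasis e) (hq : 3 ≤ q) {βseq hseq : ℕ → ℝ}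
    (hβs : Tendsto (fun n : ℕ => (n : ℝ) ^ ((3 : ℝ) / 4) * (βseq n - beta0 q)) atTop (𝓝 0))
    (hhs : Tendsto (fun n : ℕ => (n : ℝ) ^ ((3 : ℝ) / 4) * (hseq n - h0 q)) atTop (𝓝 0))
    (hxmin : ∀ y ∈ simplex q,
      ((∀ z ∈ simplex q, freeEnergy q (beta0 q) (h0 q) y ≤ freeEnergy q (beta0 q) (h0 q) z)
        ↔ y = xzero q)) (a : ℝ) (b : ι → ℝ) :
    Tendsto (fun n : ℕ => (∑ σ : Fin n → Fin q, (cwWeight q n (βseq n) (hseq n) σ : ℂ)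
        * Complex.exp ((a * (signSum σ / (n : ℝ) ^ ((3 : ℝ) / 4))
          + ∑ j, b j * (transverseSum e σ j / (n : ℝ) ^ ((1 : ℝ) / 2)) : ℝ) * Complex.I))
          / cwZ q n (βseq n) (hseq n)) atTop
      (𝓝 (quarticFourier a / quarticFourier 0
        * Complex.exp
          (-((q / (2 * ((q : ℝ) - 1) * ((q : ℝ) - 2)) / 2 * ∑ j, b j ^ 2 : ℝ) : ℂ)))) := by
  have hb := beta0_pos hq
  set ρ : ℕ → ℝ := fun n => (n : ℝ) ^ ((1 : ℝ) / 4) with hρdef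
  set r : ℕ → ℝ := fun n => βseq n / beta0 q with hrdef
  set δ : ℕ → ℝ := fun n => ρ n ^ 3 * fieldShift q (βseq n) (hseq n) with hδdef
  have hρ4 : ∀ n, ρ n ^ 4 = n := fun n => (rpow_quarter_pow n).1
  have hρ3 : ∀ n : ℕ, ρ n ^ 3 = (n : ℝ) ^ ((3 : ℝ) / 4) := fun n => (rpow_quarter_pow n).2.1
  have hρ2 : ∀ n : ℕ, ρ n ^ 2 = (n : ℝ) ^ ((1 : ℝ) / 2) := fun n => (rpow_quarter_pow n).2.2
  have hρ : Tendsto ρ atTop atTop :=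
    (tendsto_rpow_atTop (by norm_num)).comp tendsto_natCast_atTop_atTop
  have hρinv : Tendsto (fun n => (ρ n)⁻¹) atTop (𝓝 0) := tendsto_inv_atTop_zero.comp hρ
  have hρpos : ∀ᶠ n in atTop, 0 < ρ n := hρ.eventually_gt_atTop 0
  simp only [← hρ3] at hβs hhs
  have hr3 : Tendsto (fun n => ρ n ^ 3 * (r n - 1)) atTop (𝓝 0) := by
    have := hβs.div_const (beta0 q)
    rw [zero_div] at this
    refine this.congr fun n => ?_
    simp only [hrdef]
    field_simp
  have hr2 : Tendsto (fun n => (r n - 1) * ρ n ^ 2) atTop (𝓝 0) := by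
    have := hr3.mul hρinv
    rw [zero_mul] at this
    refine this.congr' ?_
    filter_upwards [hρpos] with n hn
    field_simp
  have hr1 : Tendsto (fun n => r n - 1) atTop (𝓝 0) := by
    have := (hr2.mul hρinv).mul hρinv
    rw [zero_mul, zero_mul] at this
    refine this.congr' ?_
    filter_upwards [hρpos] with n hn
    field_simp
  have hr : Tendsto r atTop (𝓝 1) := by
    simpa using hr1.add_const 1
  have hrpos : ∀ᶠ n in atTop, 0 < r n := hr.eventually_const_lt one_pos
  have hrinv : Tendsto (fun n => 1 / r n) atTop (𝓝 1) := by
    simpa using hr.inv₀ one_ne_zero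
  have hη : Tendsto (fun n => 1 / r n - 1) atTop (𝓝 0) := by
    simpa using hrinv.sub_const 1
  have hηρ : Tendsto (fun n => (1 / r n - 1) * ρ n ^ 2) atTop (𝓝 0) := by
    have := (hr2.mul hrinv).neg
    rw [zero_mul, neg_zero] at this
    refine this.congr' ?_
    filter_upwards [hrpos] with n hn
    field_simp
    ring
  have hδ : Tendsto δ atTop (𝓝 0) := by
    have := (hβs.mul_const ((1 - 1 / ((q : ℝ) - 1)) / 4)).add (hhs.div_const 2)
    rw [zero_mul, zero_div, add_zero] at this
    refine this.congr fun n => ?_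
    simp only [hδdef, fieldShift]
    ring
  have hε : Tendsto (fun n => δ n / r n) atTop (𝓝 0) := by
    have := hδ.div hr one_ne_zero
    rwa [zero_div] at this
  have hdiv : ∀ c : ℝ, Tendsto (fun n => c / r n) atTop (𝓝 c) := fun c => by
    have := (tendsto_const_nhds (x := c)).div hr one_ne_zero
    rwa [div_one] at this
  have hJ := tendsto_integral_scaledRate he hq hxmin hρ hηρ hη hε
    (a := fun n => a / r n) (b := fun n j => b j / r n) (a' := a) (b' := b)
    (hdiv a) (tendsto_pi_nhds.2 fun j => hdiv (b j))
  have hJ0 := tendsto_integral_scaledRate he hq hxmin hρ hηρ hη hε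
    (tendsto_const_nhds (x := (0 : ℝ))) (tendsto_const_nhds (x := (0 : ι → ℝ)))
  have hγ := beta0_mul_sub_pos hq
  rw [integral_limit_eq hγ] at hJ hJ0
  have hrC : Tendsto (fun n => (r n : ℂ)) atTop (𝓝 1) := by
    exact_mod_cast (Complex.continuous_ofReal.tendsto 1).comp hr
  have hδC : Tendsto (fun n => (δ n : ℂ)) atTop (𝓝 0) := by
    exact_mod_cast (Complex.continuous_ofReal.tendsto 0).comp hδ
  have hρC : Tendsto (fun n => ((ρ n : ℂ) ^ 2)⁻¹) atTop (𝓝 0) := by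
    have h := (Complex.continuous_ofReal.tendsto (0 ^ 2)).comp (hρinv.pow 2)
    rw [zero_pow two_ne_zero, Complex.ofReal_zero] at h
    exact h.congr fun n => by simp
  have hbC : (beta0 q : ℂ) ≠ 0 := by exact_mod_cast hb.ne'
  have hE : Tendsto (fun n => Complex.exp (((∑ j, b j ^ 2 : ℝ) : ℂ) / (2 * r n * beta0 q)
      - ((a * Complex.I - δ n) ^ 2 - δ n ^ 2) / (2 * r n * ρ n ^ 2))) atTop
      (𝓝 (Complex.exp (((∑ j, b j ^ 2 : ℝ) : ℂ) / (2 * beta0 q)))) := by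
    have h1 : Tendsto (fun n => ((∑ j, b j ^ 2 : ℝ) : ℂ) / (2 * r n * beta0 q)) atTop
        (𝓝 (((∑ j, b j ^ 2 : ℝ) : ℂ) / (2 * 1 * beta0 q))) :=
      tendsto_const_nhds.div ((hrC.const_mul 2).mul_const _) (by simpa using hbC)
    have h2 : Tendsto (fun n => ((a * Complex.I - δ n) ^ 2 - (δ n : ℂ) ^ 2) / (2 * r n)
        * ((ρ n : ℂ) ^ 2)⁻¹) atTop
        (𝓝 (((a * Complex.I - 0) ^ 2 - (0 : ℂ) ^ 2) / (2 * 1) * 0)) :=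
      ((((hδC.const_sub _).pow 2).sub (hδC.pow 2)).div (hrC.const_mul 2) (by norm_num)).mul hρC
    have h3 := (h1.sub h2).cexp
    rw [mul_zero, sub_zero, mul_one] at h3
    refine h3.congr fun n => ?_
    rw [← div_eq_mul_inv, div_div]
  have hP : (π / (beta0 q * (1 - 2 / q) / 2 : ℝ) : ℂ) ^ (Fintype.card ι / 2 : ℂ) ≠ 0 := by
    rw [Complex.cpow_def_of_ne_zero]
    · exact Complex.exp_ne_zero _
    · have : (0 : ℝ) < π / (beta0 q * (1 - 2 / q) / 2) := by positivity
      exact_mod_cast this.ne'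
  have hlim := (hE.mul hJ).div hJ0 (mul_ne_zero (mul_ne_zero quarticFourier_zero_ne_zero hP)
    (Complex.exp_ne_zero _))
  have hval : Complex.exp (-((q / (2 * ((q : ℝ) - 1) * ((q : ℝ) - 2)) / 2 * ∑ j, b j ^ 2 : ℝ) : ℂ))
      = Complex.exp (((∑ j, b j ^ 2 : ℝ) : ℂ) / (2 * beta0 q))
        * Complex.exp (-(∑ j, b j ^ 2 : ℝ) / (2 * (beta0 q * (1 - 2 / q) : ℝ))) := by
    rw [← inv_sub_inv_beta0 hq, ← Complex.exp_add]
    congr 1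
    push_cast
    ring
  have hQ := quarticFourier_zero_ne_zero
  convert hlim.congr' ?_ using 2
  · rw [hval]
    simp only [Pi.zero_apply, ne_eq, OfNat.ofNat_ne_zero, not_false_eq_true, zero_pow,
      Finset.sum_const_zero, Complex.ofReal_zero, neg_zero, zero_div, Complex.exp_zero, mul_one]
    generalize (π / (beta0 q * (1 - 2 / q) / 2 : ℝ) : ℂ) ^ (Fintype.card ι / 2 : ℂ) = P at hP ⊢
    field_simp
  · filter_upwards [hρpos, hrpos, eventually_ne_atTop 0] with n hn hrn hn0
    have hβ : 0 < βseq n := by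
      have := mul_pos hrn hb
      rwa [div_mul_cancel₀ _ hb.ne'] at this
    simp only [← hρ3, ← hρ2]
    exact (charFun_eq_div he hq hn0 hn (hρ4 n) hβ (hseq n) a b rfl rfl).symm

end

/-- The probability measure on `ℝ` with density proportional to `exp (-k * t ^ 4)`. -/
noncomputable def quarticMeasure (k : ℝ) : Measure ℝ :=
  (volume : Measure ℝ).withDensity fun t =>
    ENNReal.ofReal ((∫ s, Real.exp (-k * s ^ 4))⁻¹ * Real.exp (-k * t ^ 4))

lemma isProbabilityMeasure_quarticMeasure {k : ℝ} (hk : 0 < k) :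
    IsProbabilityMeasure (quarticMeasure k) := by
  have hi := integrable_exp_neg_mul_pow_four hk
  have hpos := integral_exp_pos hi
  refine ⟨?_⟩
  rw [quarticMeasure, withDensity_apply _ MeasurableSet.univ, setLIntegral_univ,
    ← ofReal_integral_eq_lintegral_ofReal (hi.const_mul _)
      (Eventually.of_forall fun t => by positivity),
    integral_const_mul, inv_mul_cancel₀ hpos.ne', ENNReal.ofReal_one]

lemma integral_cexp_quarticMeasure {m : ℝ} (hm : 0 < m) (a : ℝ) :
    ∫ t, Complex.exp ((a * t : ℝ) * Complex.I) ∂quarticMeasure (4 * m ^ 4 / 3)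
      = quarticFourier (a / (2 * m)) / quarticFourier 0 := by
  have hsub : ∀ b : ℝ, ∫ t : ℝ, Complex.exp (-(4 * m ^ 4 / 3 * t ^ 4 : ℝ)
      + (b * t : ℝ) * Complex.I) = |(2 * m)⁻¹| • quarticFourier (b / (2 * m)) := by
    intro b
    rw [quarticFourier, ← Measure.integral_comp_mul_left (fun x : ℝ =>
      Complex.exp (-(x ^ 4 / 12 : ℝ) + (b / (2 * m) * x : ℝ) * Complex.I))]
    congr 1
    ext t
    congr 3
    · congr 1; ring
    · congr 1; field_simp
  have hK : ((∫ s, Real.exp (-(4 * m ^ 4 / 3) * s ^ 4) : ℝ) : ℂ)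
      = |(2 * m)⁻¹| • quarticFourier 0 := by
    rw [← integral_complex_ofReal, ← zero_div (2 * m), ← hsub 0]
    congr 1
    ext s
    push_cast
    congr 1; ring
  rw [quarticMeasure, integral_withDensity_eq_integral_toReal_smul (by fun_prop)
    (Eventually.of_forall fun _ => ENNReal.ofReal_lt_top)]
  have h : ∀ t : ℝ, (ENNReal.ofReal ((∫ s, Real.exp (-(4 * m ^ 4 / 3) * s ^ 4))⁻¹
      * Real.exp (-(4 * m ^ 4 / 3) * t ^ 4))).toReal • Complex.exp ((a * t : ℝ) * Complex.I)
      = ((∫ s, Real.exp (-(4 * m ^ 4 / 3) * s ^ 4) : ℝ) : ℂ)⁻¹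
        * Complex.exp (-(4 * m ^ 4 / 3 * t ^ 4 : ℝ) + (a * t : ℝ) * Complex.I) := by
    intro t
    rw [ENNReal.toReal_ofReal (by positivity), Complex.real_smul, Complex.exp_add,
      Complex.ofReal_mul, Complex.ofReal_inv, Complex.ofReal_exp, mul_assoc, neg_mul,
      Complex.ofReal_neg]
  simp only [h]
  have hm' : ((|(2 * m)⁻¹| : ℝ) : ℂ) ≠ 0 := by
    have : |(2 * m)⁻¹| ≠ 0 := by positivity
    exact_mod_cast this
  rw [integral_const_mul, hsub, hK, Complex.real_smul, Complex.real_smul, ← div_eq_inv_mul,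
    mul_div_mul_left _ _ hm']

lemma IsCenteredGaussianWithCov.integral_cexp {q : ℕ} {K : Matrix (Fin q) (Fin q) ℝ}
    {ν : Measure (Fin q → ℝ)} (hν : IsCenteredGaussianWithCov q K ν) (b : Fin q → ℝ)
    (hK : 0 ≤ ∑ i, ∑ j, b i * K i j * b j) :
    ∫ y, Complex.exp ((∑ i, b i * y i : ℝ) * Complex.I) ∂ν
      = Complex.exp (-((∑ i, ∑ j, b i * K i j * b j) / 2 : ℝ)) := by
  have hm : Measurable fun y : Fin q → ℝ => ∑ i, b i * y i := by fun_prop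
  have h := hν.2 b
  revert h hK
  generalize ∑ i, ∑ j, b i * K i j * b j = v
  intro hv h
  have h1 : charFun (ν.map fun y => ∑ i, b i * y i) 1
      = charFun (ProbabilityTheory.gaussianReal 0 v.toNNReal) 1 := by rw [h]
  rw [charFun_apply_real, integral_map hm.aemeasurable (by fun_prop),
    ProbabilityTheory.charFun_gaussianReal] at h1
  simp only [Complex.ofReal_one, one_mul, Complex.ofReal_zero, zero_mul, one_pow,
    mul_one, zero_sub, Real.coe_toNNReal _ hv] at h1
  rw [h1]
  push_cast
  rfl

lemma cwWeight_pos (q n : ℕ) [NeZero q] (β h : ℝ) (σ : Fin n → Fin q) : 0 < cwWeight q n β h σ :=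
  Real.exp_pos _

/-- The law of `(T, V)` under the Curie–Weiss Potts measure. -/
noncomputable def fluctuationLaw (q n : ℕ) [NeZero q] (β h : ℝ) : Measure (ℝ × (Fin q → ℝ)) :=
  ∑ σ : Fin n → Fin q, ENNReal.ofReal (cwWeight q n β h σ / cwZ q n β h)
    • Measure.dirac (Tstat q n σ, Vstat q n σ)

instance (q n : ℕ) [NeZero q] (β h : ℝ) : IsProbabilityMeasure (fluctuationLaw q n β h) := by
  have hZ := cwZ_pos q n β h
  refine ⟨?_⟩
  simp only [fluctuationLaw, Measure.coe_finsetSum, Finset.sum_apply, Measure.smul_apply,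
    measure_univ, smul_eq_mul, mul_one]
  rw [← ENNReal.ofReal_sum_of_nonneg fun σ _ =>
      div_nonneg (cwWeight_pos q n β h σ).le hZ.le,
    ← Finset.sum_div, ← cwZ, div_self hZ.ne', ENNReal.ofReal_one]

lemma integral_fluctuationLaw {E : Type*} [NormedAddCommGroup E] [NormedSpace ℝ E]
    [CompleteSpace E] (q n : ℕ) [NeZero q] (β h : ℝ) {f : ℝ × (Fin q → ℝ) → E}
    (hf : Continuous f) :
    ∫ p, f p ∂fluctuationLaw q n β h
      = ∑ σ, (cwWeight q n β h σ / cwZ q n β h) • f (Tstat q n σ, Vstat q n σ) := by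
  have hZ := cwZ_pos q n β h
  rw [fluctuationLaw, integral_finsetSum_measure fun σ _ =>
    (integrable_dirac' hf.stronglyMeasurable (by simp)).smul_measure ENNReal.ofReal_ne_top]
  refine Finset.sum_congr rfl fun σ _ => ?_
  rw [integral_smul_measure, integral_dirac' _ _ hf.stronglyMeasurable,
    ENNReal.toReal_ofReal (div_nonneg (cwWeight_pos q n β h σ).le hZ.le)]

lemma integral_cexp_fluctuationLaw {q n : ℕ} [NeZero q] {ι : Type*} [Fintype ι] [DecidableEq ι]
    {e : ι → Fin q → ℝ} (he : IsTransverseBasis e) (hq : 2 ≤ q) (hn : n ≠ 0) (β h a : ℝ)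
    (b : Fin q → ℝ) :
    ∫ p, Complex.exp ((a * p.1 + ∑ k, b k * p.2 k : ℝ) * Complex.I) ∂fluctuationLaw q n β h
      = (∑ σ : Fin n → Fin q, (cwWeight q n β h σ : ℂ)
        * Complex.exp ((a / (2 * ((q : ℝ) - 1)) * (signSum σ / (n : ℝ) ^ ((3 : ℝ) / 4))
          + ∑ j, (∑ k, b k * e j k) * (transverseSum e σ j / (n : ℝ) ^ ((1 : ℝ) / 2)) : ℝ)
            * Complex.I)) / cwZ q n β h := by
  rw [integral_fluctuationLaw q n β h (by fun_prop), Finset.sum_div]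
  refine Finset.sum_congr rfl fun σ _ => ?_
  rw [Complex.real_smul, Complex.ofReal_div, div_mul_eq_mul_div]
  congr 5
  rw [Tstat_eq hq, Vstat_eq hq hn]
  congr 1
  · ring
  · simp only [countDev_eq he hq, Finset.sum_div, Finset.mul_sum, Finset.sum_mul]
    rw [Finset.sum_comm]
    exact Finset.sum_congr rfl fun j _ => Finset.sum_congr rfl fun k _ => by ring

/-- non-Gaussian fluctuations at the extremity `(β_0,h_0)` of the
critical line: `(T,V)` converges in law to a product measure (so `T` and `V` are
asymptotically independent), `T` with density proportional to
`exp(−(4(q−1)⁴/3) t⁴)`, and `V` centered Gaussian with the stated covariance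
matrix of rank `q − 2`. -/
theorem stmt_16 (q : ℕ) [NeZero q] (hq : 3 ≤ q)
    (βseq hseq : ℕ → ℝ)
    (hβs : Tendsto (fun n : ℕ => (n : ℝ) ^ ((3 : ℝ) / 4) * (βseq n - beta0 q))
      atTop (𝓝 0))
    (hhs : Tendsto (fun n : ℕ => (n : ℝ) ^ ((3 : ℝ) / 4) * (hseq n - h0 q))
      atTop (𝓝 0))
    (hxmin : ∀ y ∈ simplex q,
      ((∀ z ∈ simplex q, freeEnergy q (beta0 q) (h0 q) y ≤ freeEnergy q (beta0 q) (h0 q) z)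
        ↔ y = xzero q)) :
    ∃ (νT : Measure ℝ) (νV : Measure (Fin q → ℝ)),
      IsProbabilityMeasure νT ∧
      (∃ c : ℝ, 0 < c ∧ νT = (volume : Measure ℝ).withDensity
        (fun t => ENNReal.ofReal
          (c * Real.exp (-(4 * ((q : ℝ) - 1) ^ 4 / 3) * t ^ 4)))) ∧
      IsCenteredGaussianWithCov q (covV q) νV ∧
      (covV q).rank = q - 2 ∧
      ∀ g : ℝ × (Fin q → ℝ) → ℝ, Continuous g → (∃ C : ℝ, ∀ p, |g p| ≤ C) →
        Tendsto (fun n : ℕ => cwExp q n (βseq n) (hseq n)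
            (fun σ => g (Tstat q n σ, Vstat q n σ)))
          atTop (𝓝 (∫ p, g p ∂(νT.prod νV))) := by
  have hq3 : (3 : ℝ) ≤ q := by exact_mod_cast hq
  have hm : (0 : ℝ) < (q : ℝ) - 1 := by linarith
  have hk : (0 : ℝ) < 4 * ((q : ℝ) - 1) ^ 4 / 3 := by positivity
  obtain ⟨e, he1, he2, he3, he4⟩ := exists_orthonormal_family q hq
  have he : IsTransverseBasis e := ⟨he1, he2, he3, he4⟩
  have hνV := he.isCenteredGaussianWithCov hq
  set νV := (Measure.pi fun _ : Fin (q - 2) => ProbabilityTheory.gaussianReal 0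
    (Real.toNNReal ((q : ℝ) / (2 * ((q : ℝ) - 1) * ((q : ℝ) - 2))))).map
    (fun w k => ∑ j, w j * e j k)
  have hT := isProbabilityMeasure_quarticMeasure hk
  have hV : IsProbabilityMeasure νV := hνV.1
  refine ⟨quarticMeasure (4 * ((q : ℝ) - 1) ^ 4 / 3), νV, hT, ⟨_,
    inv_pos.2 (integral_exp_pos (integrable_exp_neg_mul_pow_four hk)), rfl⟩, hνV,
    by rw [he.rank_covV hq, Fintype.card_fin], fun g hg hb => ?_⟩
  have hlaw := tendsto_integral_of_tendsto_integral_cexp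
    (fun n => fluctuationLaw q n (βseq n) (hseq n))
    ((quarticMeasure (4 * ((q : ℝ) - 1) ^ 4 / 3)).prod νV) ?_ hg hb
  · refine hlaw.congr fun n => ?_
    rw [integral_fluctuationLaw q n _ _ hg, cwExp, Finset.sum_div]
    exact Finset.sum_congr rfl fun σ _ => by rw [smul_eq_mul, div_mul_eq_mul_div]
  · intro a b
    have hlim := tendsto_charFun he hq hβs hhs hxmin (a / (2 * ((q : ℝ) - 1)))
      fun j => ∑ k, b k * e j k
    have hs : 0 ≤ (q : ℝ) / (2 * ((q : ℝ) - 1) * ((q : ℝ) - 2)) :=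
      div_nonneg (by linarith) (mul_nonneg (by linarith) (by linarith))
    have hprod : ∫ p, Complex.exp ((a * p.1 + ∑ k, b k * p.2 k : ℝ) * Complex.I)
        ∂(quarticMeasure (4 * ((q : ℝ) - 1) ^ 4 / 3)).prod νV
        = (∫ t, Complex.exp ((a * t : ℝ) * Complex.I)
            ∂quarticMeasure (4 * ((q : ℝ) - 1) ^ 4 / 3))
          * ∫ y, Complex.exp ((∑ k, b k * y k : ℝ) * Complex.I) ∂νV := by
      rw [← integral_prod_mul]
      congr 1
      ext p
      rw [← Complex.exp_add, ← add_mul, ← Complex.ofReal_add]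
    rw [hprod, integral_cexp_quarticMeasure hm, hνV.integral_cexp b
      (by rw [he.quadForm_covV hq]; exact mul_nonneg hs (Finset.sum_nonneg fun _ _ => sq_nonneg _)),
      he.quadForm_covV hq, ← div_mul_eq_mul_div]
    refine hlim.congr' ?_
    filter_upwards [eventually_ne_atTop 0] with n hn
    exact (integral_cexp_fluctuationLaw he (by omega) hn _ _ a b).symm
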